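/- Let n ≥ 3 and let a ≥ 1/(n-2). Then for every v ∈ C_c^∞(B_1), ∫_{B_1} |x|^{-(n-2)} |∇v|² dx ≥ (n-2)^{-2(n-1)/n} S_n · ( ∫_{B_1} |x|^{-n} X_1(a,|x|)^{2(n-1)/(n-2)} |v|^{2n/(n-2)} dx )^{(n-2)/n}. (This is the limiting case b = −(n−2)/2 of the Caffarelli–Kohn–Nirenberg inequality.) -/

import Mathlib

open MeasureTheory Real

/-- The best Sobolev constant `S_n = π n (n-2) (Γ(n/2)/Γ(n))^(2/n)`. -/
noncomputable def sobolevConst (n : ℕ) : ℝ :=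
  Real.pi * n * ((n : ℝ) - 2) * (Real.Gamma ((n : ℝ) / 2) / Real.Gamma (n : ℝ)) ^ (2 / (n : ℝ))

/-- `X_1(a,s) = (a - ln s)⁻¹`. -/
noncomputable def X1 (a s : ℝ) : ℝ := (a - Real.log s)⁻¹

/-- The total mass of `(1 + z ^ 2) ^ (-s)` on the real line. -/
noncomputable def studentMass (s : ℝ) : ℝ := √π * Gamma (s - 1 / 2) / Gamma s

lemma studentMass_pos {s : ℝ} (hs : 1 / 2 < s) : 0 < studentMass s := by
  have h1 := Gamma_pos_of_pos (show 0 < s by linarith)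
  have h2 := Gamma_pos_of_pos (show 0 < s - 1 / 2 by linarith)
  unfold studentMass
  have := Real.pi_pos
  positivity

lemma lintegral_rpow_mul_exp_neg_mul {a r : ℝ} (ha : 0 < a) (hr : 0 < r) :
    ∫⁻ t in Set.Ioi (0 : ℝ), ENNReal.ofReal (t ^ (a - 1) * exp (-(r * t))) =
      ENNReal.ofReal ((1 / r) ^ a * Gamma a) := by
  have h := Real.integral_rpow_mul_exp_neg_mul_Ioi ha hr
  have hpos : 0 < (1 / r) ^ a * Gamma a := by
    have := Gamma_pos_of_pos ha
    positivity
  rw [← h, ofReal_integral_eq_lintegral_ofReal]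
  · exact Integrable.of_integral_ne_zero (by rw [h]; exact hpos.ne')
  · filter_upwards [ae_restrict_mem measurableSet_Ioi] with t ht
    have : (0 : ℝ) < t := ht
    simp only [Pi.zero_apply]
    positivity

lemma lintegral_exp_neg_mul_sq {t : ℝ} (ht : 0 < t) :
    ∫⁻ z : ℝ, ENNReal.ofReal (exp (-t * z ^ 2)) = ENNReal.ofReal (√(π / t)) := by
  rw [← integral_gaussian t, ofReal_integral_eq_lintegral_ofReal]
  · exact integrable_exp_neg_mul_sq ht
  · exact Filter.Eventually.of_forall fun z => (exp_pos _).le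

lemma lintegral_one_add_sq_rpow_neg {s : ℝ} (hs : 1 / 2 < s) :
    ∫⁻ z : ℝ, ENNReal.ofReal ((1 + z ^ 2) ^ (-s)) = ENNReal.ofReal (studentMass s) := by
  have hs0 : 0 < s := by linarith
  have hG := Gamma_pos_of_pos hs0
  have key : ENNReal.ofReal (Gamma s) * ∫⁻ z : ℝ, ENNReal.ofReal ((1 + z ^ 2) ^ (-s)) =
      ENNReal.ofReal (√π * Gamma (s - 1 / 2)) := by
    rw [← lintegral_const_mul _ (by fun_prop)]
    have h1 : ∀ z : ℝ, ENNReal.ofReal (Gamma s) * ENNReal.ofReal ((1 + z ^ 2) ^ (-s)) =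
        ∫⁻ t in Set.Ioi (0 : ℝ), ENNReal.ofReal (t ^ (s - 1) * exp (-((1 + z ^ 2) * t))) := by
      intro z
      have hz : 0 < 1 + z ^ 2 := by positivity
      rw [lintegral_rpow_mul_exp_neg_mul hs0 hz, ← ENNReal.ofReal_mul hG.le, rpow_neg hz.le,
        one_div, inv_rpow hz.le, mul_comm]
    simp_rw [h1]
    rw [lintegral_lintegral_swap (by fun_prop)]
    have h2 : ∀ t ∈ Set.Ioi (0 : ℝ),
        ∫⁻ z : ℝ, ENNReal.ofReal (t ^ (s - 1) * exp (-((1 + z ^ 2) * t))) =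
          ENNReal.ofReal (√π) * ENNReal.ofReal (t ^ ((s - 1 / 2) - 1) * exp (-(1 * t))) := by
      intro t ht
      have ht : 0 < t := ht
      have h3 : ∀ z : ℝ, ENNReal.ofReal (t ^ (s - 1) * exp (-((1 + z ^ 2) * t))) =
          ENNReal.ofReal (t ^ (s - 1) * exp (-t)) * ENNReal.ofReal (exp (-t * z ^ 2)) := by
        intro z
        rw [← ENNReal.ofReal_mul (by positivity), mul_assoc, ← exp_add]
        ring_nf
      simp_rw [h3]
      rw [lintegral_const_mul _ (by fun_prop), lintegral_exp_neg_mul_sq ht,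
        ← ENNReal.ofReal_mul (by positivity), ← ENNReal.ofReal_mul (by positivity)]
      congr 1
      rw [sqrt_div pi_pos.le, sqrt_eq_rpow t, show s - 1 / 2 - 1 = (s - 1) - 1 / 2 by ring,
        rpow_sub ht (s - 1) (1 / 2), one_mul]
      ring
    rw [setLIntegral_congr_fun measurableSet_Ioi h2, lintegral_const_mul _ (by fun_prop),
      lintegral_rpow_mul_exp_neg_mul (by linarith) one_pos,
      ← ENNReal.ofReal_mul (by positivity)]
    simp
  have h0 : ENNReal.ofReal (Gamma s) ≠ 0 := by simpa using hG
  rw [studentMass, ENNReal.ofReal_div_of_pos hG, ← key, mul_comm,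
    ENNReal.mul_div_cancel_right h0 ENNReal.ofReal_ne_top]

lemma studentMass_sub_one {s : ℝ} (hs : 3 / 2 < s) :
    studentMass (s - 1) = studentMass s * ((2 * s - 2) / (2 * s - 3)) := by
  have h1 : Gamma s = (s - 1) * Gamma (s - 1) := by
    rw [← Gamma_add_one (by linarith)]; ring_nf
  have h2 : Gamma (s - 1 / 2) = (s - 3 / 2) * Gamma (s - 1 - 1 / 2) := by
    rw [show s - 1 - 1 / 2 = s - 3 / 2 by ring, ← Gamma_add_one (by linarith)]; ring_nf
  have h3 := (Gamma_pos_of_pos (show 0 < s - 1 by linarith)).ne'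
  unfold studentMass
  rw [h1, h2]
  generalize Gamma (s - 1 - 1 / 2) = G
  have : s - 1 ≠ 0 := by linarith
  have : 2 * s - 3 ≠ 0 := by linarith
  have h4 : s * 2 - 3 ≠ 0 := by linarith
  rw [show s - 3 / 2 = (2 * s - 3) / 2 by ring, show 2 * s - 2 = 2 * (s - 1) by ring]
  field_simp

lemma hasDerivAt_integral_Iic {f : ℝ → ℝ} (hc : Continuous f) (hi : Integrable f) (x : ℝ) :
    HasDerivAt (fun x => ∫ t in Set.Iic x, f t) (f x) x := by
  have h : (fun x => ∫ t in Set.Iic x, f t) =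
      fun x => (∫ t in (0 : ℝ)..x, f t) + ∫ t in Set.Iic 0, f t := by
    funext x
    rw [← intervalIntegral.integral_Iic_sub_Iic hi.integrableOn hi.integrableOn]
    ring
  rw [h]
  exact (intervalIntegral.integral_hasDerivAt_right (hc.intervalIntegrable _ _)
    (hc.stronglyMeasurableAtFilter _ _) hc.continuousAt).add_const _

lemma tendsto_integral_Iic_atTop {f : ℝ → ℝ} (hi : Integrable f) :
    Filter.Tendsto (fun x => ∫ t in Set.Iic x, f t) Filter.atTop (nhds (∫ t, f t)) := by
  exact (aecover_Iic Filter.tendsto_id).integral_tendsto_of_countably_generated hi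

lemma tendsto_integral_Iic_atBot {f : ℝ → ℝ} (hi : Integrable f) :
    Filter.Tendsto (fun x => ∫ t in Set.Iic x, f t) Filter.atBot (nhds 0) := by
  have h : (fun x => ∫ t in Set.Iic x, f t) =
      fun x => (∫ t, f t) - ∫ t in Set.Ioi x, f t := by
    funext x
    rw [← intervalIntegral.integral_Iic_add_Ioi (b := x) hi.integrableOn hi.integrableOn]
    ring
  rw [h]
  have := ((aecover_Ioi (μ := volume) (a := fun x : ℝ => x)
    Filter.tendsto_id).integral_tendsto_of_countably_generated hi).const_sub (∫ t, f t)
  simpa using this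

/-- Monotone rearrangement: a continuous density is transported onto a positive one of the same
mass by a map that solves the Monge-Ampère equation on the line. -/
lemma exists_monotone_transport {f h : ℝ → ℝ} (hfc : Continuous f) (hfi : Integrable f)
    (hf0 : ∀ x, 0 ≤ f x) (hhc : Continuous h) (hhi : Integrable h) (hh0 : ∀ x, 0 < h x)
    (hfh : ∫ x, f x = ∫ x, h x) :
    ∃ (Z : ℝ → ℝ) (I : Set ℝ), Measurable Z ∧ MeasurableSet I ∧ (∀ x ∉ I, f x = 0) ∧
      (∀ x ∈ I, HasDerivAt Z (f x / h (Z x)) x) ∧ MonotoneOn Z I ∧ Z '' I = Set.univ := by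
  set c := ∫ x, h x with hc
  set F : ℝ → ℝ := fun x => ∫ t in Set.Iic x, f t with hF
  set H : ℝ → ℝ := fun x => ∫ t in Set.Iic x, h t with hH
  have dF := hasDerivAt_integral_Iic hfc hfi
  have dH := hasDerivAt_integral_Iic hhc hhi
  have cF : Continuous F := continuous_iff_continuousAt.2 fun x => (dF x).continuousAt
  have cH : Continuous H := continuous_iff_continuousAt.2 fun x => (dH x).continuousAt
  have mF : Monotone F := monotone_of_hasDerivAt_nonneg dF hf0
  have mH : StrictMono H := strictMono_of_hasDerivAt_pos dH hh0
  have tF := tendsto_integral_Iic_atTop hfi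
  have tH := tendsto_integral_Iic_atTop hhi
  have bF := tendsto_integral_Iic_atBot hfi
  have bH := tendsto_integral_Iic_atBot hhi
  rw [hfh] at tF
  have F0 : ∀ x, 0 ≤ F x := fun x => mF.le_of_tendsto bF x
  have Fc : ∀ x, F x ≤ c := fun x => mF.ge_of_tendsto tF x
  have H0 : ∀ x, 0 < H x := fun x =>
    (mH.monotone.le_of_tendsto bH (x - 1)).trans_lt (mH (by linarith))
  have Hc : ∀ x, H x < c := fun x =>
    (mH (show x < x + 1 by linarith)).trans_le (mH.monotone.ge_of_tendsto tH (x + 1))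
  have surj : ∀ {G : ℝ → ℝ}, Continuous G → Filter.Tendsto G Filter.atTop (nhds c) →
      Filter.Tendsto G Filter.atBot (nhds 0) → ∀ y, 0 < y → y < c → ∃ x, G x = y := by
    intro G hG h1 h2 y hy0 hyc
    obtain ⟨x1, hx1⟩ := (h1.eventually (lt_mem_nhds hyc)).exists
    obtain ⟨x2, hx2⟩ := (h2.eventually (gt_mem_nhds hy0)).exists
    exact mem_range_of_exists_le_of_exists_ge hG ⟨x2, hx2.le⟩ ⟨x1, hx1.le⟩
  set I : Set ℝ := {x | 0 < F x ∧ F x < c} with hI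
  have oI : IsOpen I := (isOpen_lt continuous_const cF).inter (isOpen_lt cF continuous_const)
  have ex : ∀ x, ∃ z, (x ∈ I → H z = F x) ∧ (x ∉ I → z = 0) := by
    intro x
    by_cases hx : x ∈ I
    · obtain ⟨z, hz⟩ := surj cH tH bH (F x) hx.1 hx.2
      exact ⟨z, fun _ => hz, fun h => absurd hx h⟩
    · exact ⟨0, fun h => absurd h hx, fun _ => rfl⟩
  choose Z hZ hZ0 using ex
  have eH : Topology.IsEmbedding H := by
    refine mH.isEmbedding_of_ordConnected ?_
    exact (isPreconnected_range cH).ordConnected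
  have cZ : ∀ x ∈ I, ContinuousAt Z x := by
    intro x hx
    rw [ContinuousAt, eH.tendsto_nhds_iff, hZ x hx]
    refine Filter.Tendsto.congr' ?_ (cF.tendsto x)
    filter_upwards [oI.mem_nhds hx] with y hy
    exact (hZ y hy).symm
  refine ⟨Z, I, ?_, oI.measurableSet, ?_, ?_, ?_, ?_⟩
  · have h1 : Z = I.piecewise Z 0 := by
      funext x
      by_cases hx : x ∈ I
      · simp [hx]
      · simp [hx, hZ0 x hx]
    rw [h1]
    exact ContinuousOn.measurable_piecewise (fun x hx => (cZ x hx).continuousWithinAt)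
      continuousOn_const oI.measurableSet
  · intro x hx
    rw [hI, Set.mem_ofPred_eq, not_and_or, not_lt, not_lt] at hx
    rcases hx with hx | hx
    · have : IsLocalMin F x := Filter.Eventually.of_forall fun y => hx.trans (F0 y)
      exact this.hasDerivAt_eq_zero (dF x)
    · have : IsLocalMax F x := Filter.Eventually.of_forall fun y => (Fc y).trans hx
      exact this.hasDerivAt_eq_zero (dF x)
  · intro x hx
    refine HasDerivAt.of_comp_left (cZ x hx) (dH (Z x)) (dF x) (hh0 _).ne' ?_
    filter_upwards [oI.mem_nhds hx] with y hy
    exact hZ y hy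
  · intro x hx y hy hxy
    rw [← mH.le_iff_le, hZ x hx, hZ y hy]
    exact mF hxy
  · refine Set.eq_univ_of_forall fun z => ?_
    obtain ⟨x, hx⟩ := surj cF tF bF (H z) (H0 z) (Hc z)
    have hxI : x ∈ I := by
      rw [hI, Set.mem_ofPred_eq, hx]
      exact ⟨H0 z, Hc z⟩
    exact ⟨x, hxI, mH.injective (by rw [hZ x hxI, hx])⟩

lemma enorm_le_lintegral_Ici_deriv {φ : ℝ → ℝ} (hφ : ContDiff ℝ 1 φ) (hc : HasCompactSupport φ)
    (x : ℝ) : ‖φ x‖ₑ ≤ ∫⁻ y in Set.Ici x, ‖deriv φ y‖ₑ := by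
  have h := HasCompactSupport.enorm_le_lintegral_Ici_deriv (f := fun y => φ (-y))
    (hφ.comp contDiff_neg) (hc.comp_homeomorph (Homeomorph.neg ℝ)) (-x)
  simp only [neg_neg, deriv_comp_neg, enorm_neg] at h
  refine h.trans_eq ?_
  rw [← lintegral_indicator measurableSet_Iic, ← lintegral_indicator measurableSet_Ici,
    ← lintegral_neg_eq_self]
  refine lintegral_congr fun y => ?_
  by_cases hy : x ≤ y
  · rw [Set.indicator_of_mem (by simpa using hy), Set.indicator_of_mem (by simpa using hy),
      neg_neg]
  · rw [Set.indicator_of_notMem (by simpa using hy), Set.indicator_of_notMem (by simpa using hy)]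

lemma setLIntegral_mul_le_of_le_tail (A : Set ℝ) {d g ψ : ℝ → ENNReal}
    (hd : Measurable d) (hg : Measurable g) {r : ℝ → ℝ → Prop}
    (hr : MeasurableSet {p : ℝ × ℝ | r p.1 p.2})
    (hψ : ∀ x, ψ x ≤ ∫⁻ y in {y | r x y}, g y) :
    ∫⁻ x in A, d x * ψ x ≤ ∫⁻ y, g y * ∫⁻ x in A ∩ {x | r x y}, d x := by
  have hr1 : ∀ x, MeasurableSet {y | r x y} := fun x => measurable_prodMk_left hr
  have hr2 : ∀ y, MeasurableSet {x | r x y} := fun y => measurable_prodMk_right hr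
  set K : ℝ → ℝ → ENNReal := fun x y =>
    Set.indicator {p : ℝ × ℝ | r p.1 p.2} (fun p => d p.1 * g p.2) (x, y) with hK
  have hKm : Measurable (Function.uncurry K) :=
    Measurable.indicator (by fun_prop) hr
  calc ∫⁻ x in A, d x * ψ x ≤ ∫⁻ x in A, ∫⁻ y, K x y := by
        refine lintegral_mono fun x => ?_
        calc d x * ψ x ≤ d x * ∫⁻ y in {y | r x y}, g y := by gcongr; exact hψ x
          _ = ∫⁻ y, K x y := by
            rw [← lintegral_const_mul _ hg, ← lintegral_indicator (hr1 x)]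
            rfl
    _ = ∫⁻ y, ∫⁻ x in A, K x y := lintegral_lintegral_swap hKm.aemeasurable
    _ = ∫⁻ y, g y * ∫⁻ x in A ∩ {x | r x y}, d x := by
        refine lintegral_congr fun y => ?_
        rw [← lintegral_const_mul _ hd, Set.inter_comm, ← Measure.restrict_restrict (hr2 y),
          ← lintegral_indicator (hr2 y)]
        refine lintegral_congr fun x => ?_
        simp only [hK, Set.indicator, Set.mem_ofPred_eq, mul_comm]

/-- Transport of a density on the line onto a Student density, with its second moment and the
resulting integration by parts inequality. -/
lemma exists_student_transport {s : ℝ} (hs : 3 / 2 < s) {ρ : ℝ → ℝ} (hρc : Continuous ρ)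
    (hρi : Integrable ρ) (hρ0 : ∀ x, 0 ≤ ρ x) (hM : 0 < ∫ x, ρ x) :
    ∃ Z : ℝ → ℝ, Measurable Z ∧
      ∫⁻ x, ENNReal.ofReal (ρ x * Z x ^ 2) = ENNReal.ofReal ((∫ x, ρ x) / (2 * s - 3)) ∧
      ∀ φ : ℝ → ℝ, ContDiff ℝ 1 φ → HasCompactSupport φ → (∀ x, 0 ≤ φ x) →
        (∀ x, ρ x = 0 → φ x = 0) →
        ∫⁻ x, ENNReal.ofReal (studentMass s * ρ x / (∫ x, ρ x) * (1 + Z x ^ 2) ^ s * φ x) ≤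
          ∫⁻ x, ENNReal.ofReal (|Z x| * |deriv φ x|) := by
  set M := ∫ x, ρ x with hMdef
  have hcs := studentMass_pos (show 1 / 2 < s by linarith)
  have hcs1 := studentMass_pos (show 1 / 2 < s - 1 by linarith)
  have hpos : ∀ z : ℝ, 0 < 1 + z ^ 2 := fun z => by positivity
  have hint : ∀ {t : ℝ}, 1 / 2 < t → Continuous (fun z : ℝ => (1 + z ^ 2) ^ (-t)) ∧
      Integrable (fun z : ℝ => (1 + z ^ 2) ^ (-t)) ∧
      ∫ z : ℝ, (1 + z ^ 2) ^ (-t) = studentMass t := by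
    intro t ht
    have hc : Continuous (fun z : ℝ => (1 + z ^ 2) ^ (-t)) :=
      Continuous.rpow_const (by fun_prop) fun z => Or.inl (hpos z).ne'
    have h0 : ∀ z : ℝ, 0 ≤ (1 + z ^ 2) ^ (-t) := fun z => (rpow_pos_of_pos (hpos z) _).le
    have hl := lintegral_one_add_sq_rpow_neg ht
    refine ⟨hc, ?_, ?_⟩
    · refine (lintegral_ofReal_ne_top_iff_integrable hc.aestronglyMeasurable
        (Filter.Eventually.of_forall h0)).1 ?_
      rw [hl]; exact ENNReal.ofReal_ne_top
    · rw [integral_eq_lintegral_of_nonneg_ae (Filter.Eventually.of_forall h0)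
        hc.aestronglyMeasurable, hl, ENNReal.toReal_ofReal (studentMass_pos ht).le]
  obtain ⟨hhc, hhi, hhv⟩ := hint (show 1 / 2 < s by linarith)
  obtain ⟨hhc1, hhi1, hhv1⟩ := hint (show 1 / 2 < s - 1 by linarith)
  obtain ⟨Z, I, hZm, hI, hIρ, hZd, hZmono, hZsurj⟩ := exists_monotone_transport
    (f := fun x => studentMass s / M * ρ x) (h := fun z : ℝ => (1 + z ^ 2) ^ (-s))
    (by fun_prop) (hρi.const_mul _) (fun x => by have := hρ0 x; positivity) hhc hhi
    (fun z => rpow_pos_of_pos (hpos z) _)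
    (by rw [integral_const_mul, ← hMdef, hhv]; field_simp)
  have hIρ : ∀ x ∉ I, ρ x = 0 := fun x hx =>
    (mul_eq_zero.1 (hIρ x hx)).resolve_left (by positivity)
  have hd : ∀ x, studentMass s / M * ρ x / (1 + Z x ^ 2) ^ (-s) =
      studentMass s * ρ x / M * (1 + Z x ^ 2) ^ s := fun x => by
    rw [rpow_neg (hpos _).le, div_inv_eq_mul]; ring
  simp only [hd] at hZd
  set d : ℝ → ℝ := fun x => studentMass s * ρ x / M * (1 + Z x ^ 2) ^ s with hddef
  have hdm : Measurable d := by fun_prop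
  have hd0 : ∀ x, 0 ≤ d x := fun x => by
    have := hρ0 x
    have := rpow_pos_of_pos (hpos (Z x)) s
    positivity
  refine ⟨Z, hZm, ?_, ?_⟩
  · have h1 : ∫⁻ x, ENNReal.ofReal (ρ x * Z x ^ 2) =
        ∫⁻ x in I, ENNReal.ofReal (ρ x * Z x ^ 2) := by
      rw [← lintegral_indicator hI]
      refine lintegral_congr fun x => ?_
      by_cases hx : x ∈ I
      · rw [Set.indicator_of_mem hx]
      · rw [Set.indicator_of_notMem hx, hIρ x hx]; simp
    have h2 := lintegral_image_eq_lintegral_deriv_mul_of_monotoneOn hI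
      (fun x hx => (hZd x hx).hasDerivWithinAt) hZmono
      (fun z => ENNReal.ofReal (M / studentMass s * (z ^ 2 * (1 + z ^ 2) ^ (-s))))
    rw [hZsurj, setLIntegral_univ] at h2
    rw [h1]
    have h3 : ∀ x ∈ I, ENNReal.ofReal (ρ x * Z x ^ 2) = ENNReal.ofReal (d x) *
        ENNReal.ofReal (M / studentMass s * (Z x ^ 2 * (1 + Z x ^ 2) ^ (-s))) := by
      intro x _
      rw [← ENNReal.ofReal_mul (hd0 x), hddef]
      congr 1
      simp only [rpow_neg (hpos (Z x)).le]
      have := rpow_pos_of_pos (hpos (Z x)) s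
      field_simp
    rw [setLIntegral_congr_fun hI h3, ← h2]
    have h4 : ∀ z : ℝ, z ^ 2 * (1 + z ^ 2) ^ (-s) =
        (1 + z ^ 2) ^ (-(s - 1)) - (1 + z ^ 2) ^ (-s) := by
      intro z
      rw [show -(s - 1) = -s + 1 by ring, rpow_add (hpos z), rpow_one]
      ring
    rw [← ofReal_integral_eq_lintegral_ofReal]
    · simp_rw [h4]
      rw [integral_const_mul, integral_sub hhi1 hhi, hhv, hhv1, studentMass_sub_one hs]
      congr 1
      have : 2 * s - 3 ≠ 0 := by linarith
      field_simp
      ring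
    · simp_rw [h4]
      exact (hhi1.sub hhi).const_mul _
    · refine Filter.Eventually.of_forall fun z => ?_
      have := rpow_pos_of_pos (hpos z) (-s)
      simp only [Pi.zero_apply]
      positivity
  · intro φ hφ hφc hφ0 hφρ
    have hφ' : ∀ y ∉ I, deriv φ y = 0 := by
      intro y hy
      have : IsLocalMin φ y := Filter.Eventually.of_forall fun x => by
        rw [hφρ y (hIρ y hy)]; exact hφ0 x
      exact this.deriv_eq_zero
    set A := I ∩ {x | 0 < Z x} with hA
    set B := I ∩ {x | Z x ≤ 0} with hB
    have hAm : MeasurableSet A := hI.inter (measurableSet_lt measurable_const hZm)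
    have hBm : MeasurableSet B := hI.inter (measurableSet_le hZm measurable_const)
    have hdisj : Disjoint A B := by
      rw [Set.disjoint_left]
      rintro x ⟨_, h1⟩ ⟨_, h2⟩
      exact not_lt.2 (show Z x ≤ 0 from h2) h1
    have hAB : A ∪ B = I := by
      rw [hA, hB, ← Set.inter_union_distrib_left]
      refine Set.inter_eq_left.2 fun x _ => ?_
      exact lt_or_ge 0 (Z x)
    have hdφ : ∀ x, ENNReal.ofReal (d x * φ x) = ENNReal.ofReal (d x) * ‖φ x‖ₑ := fun x => by
      rw [ENNReal.ofReal_mul (hd0 x), Real.enorm_of_nonneg (hφ0 x)]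
    have h1 : ∫⁻ x, ENNReal.ofReal (d x * φ x) =
        (∫⁻ x in A, ENNReal.ofReal (d x) * ‖φ x‖ₑ) +
          ∫⁻ x in B, ENNReal.ofReal (d x) * ‖φ x‖ₑ := by
      rw [← lintegral_union hBm hdisj, hAB, ← lintegral_indicator hI]
      refine lintegral_congr fun x => ?_
      by_cases hx : x ∈ I
      · rw [Set.indicator_of_mem hx, hdφ]
      · rw [Set.indicator_of_notMem hx, hφρ x (hIρ x hx)]; simp
    have hg : Measurable fun y => ‖deriv φ y‖ₑ := (measurable_deriv φ).enorm
    have hA1 := setLIntegral_mul_le_of_le_tail A (d := fun x => ENNReal.ofReal (d x))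
      hdm.ennreal_ofReal hg (r := fun x y => x ≤ y)
      (measurableSet_le measurable_fst measurable_snd)
      (fun x => enorm_le_lintegral_Ici_deriv hφ hφc x)
    have hB1 := setLIntegral_mul_le_of_le_tail B (d := fun x => ENNReal.ofReal (d x))
      hdm.ennreal_ofReal hg (r := fun x y => y ≤ x)
      (measurableSet_le measurable_snd measurable_fst)
      (fun x => HasCompactSupport.enorm_le_lintegral_Ici_deriv hφ hφc x)
    have hvol : ∀ S ⊆ I, MeasurableSet S →
        ∫⁻ x in S, ENNReal.ofReal (d x) = volume (Z '' S) := fun S hS hSm =>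
      lintegral_deriv_eq_volume_image_of_monotoneOn hSm
        (fun x hx => (hZd x (hS hx)).hasDerivWithinAt) (hZmono.mono hS)
    rw [h1]
    refine (add_le_add hA1 hB1).trans ?_
    rw [← lintegral_add_left' ?_]
    · refine lintegral_mono fun y => ?_
      by_cases hy : y ∈ I
      · rw [hvol _ (Set.inter_subset_left.trans Set.inter_subset_left)
            (hAm.inter (measurableSet_Iic (a := y)) : MeasurableSet (A ∩ {x | x ≤ y})),
          hvol _ (Set.inter_subset_left.trans Set.inter_subset_left)
            (hBm.inter (measurableSet_Ici (a := y)) : MeasurableSet (B ∩ {x | y ≤ x})),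
            ← mul_add, mul_comm,
          ENNReal.ofReal_mul (abs_nonneg _), ← Real.norm_eq_abs (deriv φ y), ofReal_norm]
        gcongr
        have hA2 : Z '' (A ∩ {x | x ≤ y}) ⊆ Set.Ioc 0 (Z y) := by
          rintro _ ⟨x, ⟨⟨hxI, hx0⟩, hxy⟩, rfl⟩
          exact ⟨hx0, hZmono hxI hy hxy⟩
        have hB2 : Z '' (B ∩ {x | y ≤ x}) ⊆ Set.Icc (Z y) 0 := by
          rintro _ ⟨x, ⟨⟨hxI, hx0⟩, hxy⟩, rfl⟩
          exact ⟨hZmono hy hxI hxy, hx0⟩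
        refine (add_le_add (measure_mono hA2) (measure_mono hB2)).trans ?_
        rw [Real.volume_Ioc, Real.volume_Icc]
        rcases le_total 0 (Z y) with h | h
        · rw [abs_of_nonneg h, ENNReal.ofReal_of_nonpos (p := 0 - Z y) (by linarith)]; simp
        · rw [abs_of_nonpos h, ENNReal.ofReal_of_nonpos (p := Z y - 0) (by linarith)]; simp
      · simp [hφ' y hy]
    · refine (hg.mul ?_).aemeasurable
      have : Monotone fun y => ∫⁻ x in A ∩ {x | x ≤ y}, ENNReal.ofReal (d x) := fun y y' h =>
        lintegral_mono_set (Set.inter_subset_inter_right _ fun x hx => le_trans hx h)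
      exact this.measurable

lemma continuous_finCons_prod {m : ℕ} :
    Continuous fun p : ℝ × (Fin m → ℝ) => (Fin.cons p.1 p.2 : Fin (m + 1) → ℝ) := by
  refine continuous_pi fun i => ?_
  refine Fin.cases ?_ (fun j => ?_) i
  · simpa using continuous_fst
  · simp only [Fin.cons_succ]
    fun_prop

lemma measurePreserving_finCons {m : ℕ} :
    MeasurePreserving (fun p : ℝ × (Fin m → ℝ) => (Fin.cons p.1 p.2 : Fin (m + 1) → ℝ)) := by
  have h := (volume_preserving_piFinSuccAbove (fun _ : Fin (m + 1) => ℝ) 0).symm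
  have h2 : (fun p : ℝ × (Fin m → ℝ) => (Fin.cons p.1 p.2 : Fin (m + 1) → ℝ)) =
      (MeasurableEquiv.piFinSuccAbove (fun _ : Fin (m + 1) => ℝ) 0).symm := by
    funext p
    rw [← Fin.insertNth_zero']
    rfl
  rw [h2]
  exact h

lemma lintegral_finCons {m : ℕ} {f : (Fin (m + 1) → ℝ) → ENNReal} (hf : Measurable f) :
    ∫⁻ y, f y = ∫⁻ x : ℝ, ∫⁻ y : Fin m → ℝ, f (Fin.cons x y) := by
  rw [← measurePreserving_finCons.lintegral_comp hf, Measure.volume_eq_prod, lintegral_prod]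
  exact (hf.comp continuous_finCons_prod.measurable).aemeasurable

lemma hasFDerivAt_finCons_right {m : ℕ} (x : ℝ) (y : Fin m → ℝ) :
    HasFDerivAt (fun y : Fin m → ℝ => (Fin.cons x y : Fin (m + 1) → ℝ))
      (ContinuousLinearMap.pi (Fin.cons 0 fun i => ContinuousLinearMap.proj (R := ℝ) i)) y := by
  refine hasFDerivAt_pi.2 fun i => ?_
  refine Fin.cases ?_ (fun j => ?_) i
  · simpa using hasFDerivAt_const x y
  · simpa using hasFDerivAt_apply j y

lemma contDiff_finCons_right {m : ℕ} (x : ℝ) :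
    ContDiff ℝ 1 fun y : Fin m → ℝ => (Fin.cons x y : Fin (m + 1) → ℝ) := by
  refine contDiff_pi.2 fun i => ?_
  refine Fin.cases ?_ (fun j => ?_) i
  · simpa using contDiff_const
  · simpa using contDiff_apply ℝ ℝ j

lemma contDiff_finCons_left {m : ℕ} (y : Fin m → ℝ) :
    ContDiff ℝ 1 fun x : ℝ => (Fin.cons x y : Fin (m + 1) → ℝ) := by
  refine contDiff_pi.2 fun i => ?_
  refine Fin.cases ?_ (fun j => ?_) i
  · simpa using contDiff_fun_id
  · simpa using contDiff_const

lemma hasDerivAt_finCons_left {m : ℕ} (x : ℝ) (y : Fin m → ℝ) :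
    HasDerivAt (fun x : ℝ => (Fin.cons x y : Fin (m + 1) → ℝ)) (Pi.single 0 1) x := by
  refine hasDerivAt_pi.2 fun i => ?_
  refine Fin.cases ?_ (fun j => ?_) i
  · simpa using hasDerivAt_id' x
  · simpa using hasDerivAt_const x (y j)

lemma fderiv_comp_finCons_right {m : ℕ} {u : (Fin (m + 1) → ℝ) → ℝ} (hu : ContDiff ℝ 1 u)
    (x : ℝ) (y : Fin m → ℝ) (i : Fin m) :
    fderiv ℝ (fun y : Fin m → ℝ => u (Fin.cons x y)) y (Pi.single i 1) =
      fderiv ℝ u (Fin.cons x y) (Pi.single i.succ 1) := by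
  have h1 := ((hu.differentiable (by simp)) (Fin.cons x y)).hasFDerivAt
  have h2 : HasFDerivAt (fun y : Fin m → ℝ => u (Fin.cons x y)) _ y :=
    h1.comp y (hasFDerivAt_finCons_right x y)
  rw [h2.fderiv, ContinuousLinearMap.comp_apply]
  congr 1
  funext j
  refine Fin.cases ?_ (fun k => ?_) j
  · simp
  · simp [Pi.single_apply]

lemma hasCompactSupport_comp_finCons_right {m : ℕ} {u : (Fin (m + 1) → ℝ) → ℝ}
    (hc : HasCompactSupport u) (x : ℝ) :
    HasCompactSupport fun y : Fin m → ℝ => u (Fin.cons x y) := by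
  refine HasCompactSupport.intro (K := Fin.tail '' tsupport u)
    (hc.isCompact.image (by unfold Fin.tail; fun_prop)) fun y hy => ?_
  by_contra h
  exact hy ⟨_, subset_tsupport _ h, Fin.tail_cons _ _⟩

lemma hasCompactSupport_comp_finCons_left {m : ℕ} {u : (Fin (m + 1) → ℝ) → ℝ}
    (hc : HasCompactSupport u) (y : Fin m → ℝ) :
    HasCompactSupport fun x : ℝ => u (Fin.cons x y) := by
  refine HasCompactSupport.intro (K := (fun z => z 0) '' tsupport u)
    (hc.isCompact.image (by fun_prop)) fun x hx => ?_
  by_contra h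
  exact hx ⟨_, subset_tsupport _ h, Fin.cons_zero _ _⟩

lemma continuous_integral_finCons {m : ℕ} {g : (Fin (m + 1) → ℝ) → ℝ} (hg : Continuous g)
    (hc : HasCompactSupport g) :
    Continuous fun x : ℝ => ∫ y : Fin m → ℝ, g (Fin.cons x y) := by
  have hK : IsCompact (Fin.tail '' tsupport g : Set (Fin m → ℝ)) :=
    hc.isCompact.image (by unfold Fin.tail; fun_prop)
  have h := continuous_parametric_integral_of_continuous (μ := volume)
    (f := fun (x : ℝ) (y : Fin m → ℝ) => g (Fin.cons x y))
    (hg.comp continuous_finCons_prod) hK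
  refine h.congr fun x => setIntegral_eq_integral_of_forall_compl_eq_zero fun y hy => ?_
  by_contra h
  exact hy ⟨_, subset_tsupport _ h, Fin.tail_cons _ _⟩

lemma integrable_comp_finCons {m : ℕ} {g : (Fin (m + 1) → ℝ) → ℝ} (hg : Continuous g)
    (hc : HasCompactSupport g) :
    Integrable fun p : ℝ × (Fin m → ℝ) => g (Fin.cons p.1 p.2) :=
  measurePreserving_finCons.integrable_comp_of_integrable (hg.integrable_of_hasCompactSupport hc)

lemma integral_finCons {m : ℕ} {g : (Fin (m + 1) → ℝ) → ℝ} (hg : Continuous g)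
    (hc : HasCompactSupport g) :
    ∫ x : ℝ, ∫ y : Fin m → ℝ, g (Fin.cons x y) = ∫ z, g z := by
  have h := integrable_comp_finCons hg hc
  rw [← measurePreserving_finCons.map_eq, integral_map
    measurePreserving_finCons.measurable.aemeasurable hg.aestronglyMeasurable]
  exact (integral_prod _ h).symm

lemma natCast_succ_mul_rpow_le {k : ℕ} {δ d : ℝ} (hδ : 0 < δ) (hd : 0 < d) :
    ((k + 1 : ℕ) : ℝ) * (δ ^ k * d) ^ (1 / ((k : ℝ) + 1)) ≤ k * δ + d := by
  have hk : (0 : ℝ) < (k : ℝ) + 1 := by positivity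
  have h := Real.geom_mean_le_arith_mean2_weighted (w₁ := k / ((k : ℝ) + 1))
    (w₂ := 1 / ((k : ℝ) + 1)) (by positivity) (by positivity) hδ.le hd.le (by field_simp)
  rw [mul_rpow (by positivity) hd.le, ← rpow_natCast, ← rpow_mul hδ.le, mul_one_div]
  calc _ ≤ ((k + 1 : ℕ) : ℝ) * (k / ((k : ℝ) + 1) * δ + 1 / ((k : ℝ) + 1) * d) := by gcongr
    _ = k * δ + d := by push_cast; field_simp

/-- The normalising constant appearing after `m` one-dimensional transport steps. -/
noncomputable def studentProd (n m : ℕ) : ℝ :=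
  ∏ j ∈ Finset.range m, (studentMass ((n : ℝ) - j / 2))⁻¹

lemma studentProd_pos {n m : ℕ} (hn : 3 ≤ n) (hm : m ≤ n) : 0 < studentProd n m := by
  have hn' : (3 : ℝ) ≤ n := by exact_mod_cast hn
  refine Finset.prod_pos fun j hj => inv_pos.2 (studentMass_pos ?_)
  have : (j : ℝ) ≤ n := by exact_mod_cast (Finset.mem_range.1 hj).le.trans hm
  linarith

/-- A dual form of the Sobolev inequality for functions of `m` variables in which `k` further
variables have been replaced by a cube of side `δ`. -/
def DualSobolev (n m k : ℕ) : Prop :=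
  ∀ u : (Fin m → ℝ) → ℝ, ContDiff ℝ 1 u → HasCompactSupport u → ∀ R δ : ℝ, 0 < R → 0 < δ →
    δ ^ k = studentProd n m * R ^ ((n : ℝ) - m / 2) * ∫ x, |u x| ^ (2 * (n : ℝ) / (n - 2)) →
    ENNReal.ofReal (((n : ℝ) - 1) * (2 * n - m) / (2 * n - m - 2) * R) *
        (∫⁻ x, ENNReal.ofReal (|u x| ^ (2 * (n : ℝ) / (n - 2)))) ≤
      ENNReal.ofReal (k * δ) * (∫⁻ x, ENNReal.ofReal (|u x| ^ (2 * ((n : ℝ) - 1) / (n - 2)))) +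
        ENNReal.ofReal (((n : ℝ) - 1) / (n - 2) ^ 2) *
          ∫⁻ x, ENNReal.ofReal (∑ i, fderiv ℝ u x (Pi.single i 1) ^ 2)

lemma dualSobolev_zero {n : ℕ} (hn : 3 ≤ n) : DualSobolev n 0 n := by
  intro u _ _ R δ hR hδ h
  have hn' : (3 : ℝ) ≤ n := by exact_mod_cast hn
  have h2 : (0 : ℝ) < n - 2 := by linarith
  have hvol : (volume : Measure (Fin 0 → ℝ)) = Measure.dirac 0 := by
    simpa using Measure.volume_pi_eq_dirac (ι := Fin 0) (α := fun _ => ℝ) 0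
  rw [hvol] at h ⊢
  simp only [lintegral_dirac, integral_dirac] at h ⊢
  refine le_trans ?_ le_self_add
  set t := |u 0| with ht
  have ht0 : 0 ≤ t := abs_nonneg _
  have hδ' : δ = R * (t ^ (2 * (n : ℝ) / (n - 2))) ^ (1 / (n : ℝ)) := by
    have h3 : δ = (δ ^ n) ^ (1 / (n : ℝ)) := by
      rw [← rpow_natCast, ← rpow_mul hδ.le, mul_one_div_cancel (by positivity), rpow_one]
    rw [h3, h]
    simp only [studentProd, Finset.range_zero, Finset.prod_empty, one_mul, CharP.cast_eq_zero,
      zero_div, sub_zero]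
    rw [mul_rpow (by positivity) (rpow_nonneg ht0 _), ← rpow_mul hR.le,
      mul_one_div_cancel (by positivity), rpow_one]
  have ha : 0 ≤ ((n : ℝ) - 1) * (2 * n - (0 : ℕ)) / (2 * n - (0 : ℕ) - 2) * R := by
    refine mul_nonneg (div_nonneg (mul_nonneg ?_ ?_) ?_) hR.le <;> push_cast <;> linarith
  rw [← ENNReal.ofReal_mul ha, ← ENNReal.ofReal_mul (by positivity)]
  refine ENNReal.ofReal_le_ofReal (le_of_eq ?_)
  rw [hδ', ← rpow_mul ht0]
  have hP : t ^ (2 * (n : ℝ) / (n - 2)) =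
      t ^ (2 * (n : ℝ) / (n - 2) * (1 / n)) * t ^ (2 * ((n : ℝ) - 1) / (n - 2)) := by
    rw [← rpow_add_of_nonneg ht0]
    · congr 1
      field_simp
      ring
    · positivity
    · exact div_nonneg (by linarith) h2.le
  rw [hP]
  have : (n : ℝ) - 1 ≠ 0 := by linarith
  simp only [CharP.cast_eq_zero, sub_zero]
  have h3 : ((n : ℝ) - 1) * (2 * n) / (2 * n - 2) = n := by
    field_simp
  rw [h3]
  ring

lemma abs_deriv_abs_rpow_le {n : ℝ} (hn : 2 < n) {u : ℝ → ℝ} (hu : Differentiable ℝ u) {R : ℝ}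
    (hR : 0 < R) (x z : ℝ) :
    √R * (|z| * |deriv (fun t => |u t| ^ (2 * (n - 1) / (n - 2))) x|) ≤
      (n - 1) / (n - 2) ^ 2 * deriv u x ^ 2 +
        (n - 1) * R * (z ^ 2 * |u x| ^ (2 * n / (n - 2))) := by
  have h2 : 0 < n - 2 := by linarith
  have hQ2 : 2 * (n - 1) / (n - 2) - 2 = 2 / (n - 2) := by field_simp; ring
  have hQ : 2 < 2 * (n - 1) / (n - 2) := by
    have : 0 < 2 / (n - 2) := by positivity
    linarith
  set Q := 2 * (n - 1) / (n - 2) with hQdef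
  have hd : HasDerivAt (fun t => |u t| ^ Q) (Q * |u x| ^ (Q - 2) * u x * deriv u x) x :=
    HasDerivAt.comp x (hasDerivAt_abs_rpow (u x) (by linarith)) (hu x).hasDerivAt
  have h0 : 0 ≤ |u x| := abs_nonneg _
  rw [hd.deriv]
  have h3 : |u x| ^ (Q - 2) * |u x| = |u x| ^ (Q - 1) := by
    rw [← rpow_add_one' h0 (by linarith)]
    congr 1; ring
  have h4 : |u x| ^ (2 * n / (n - 2)) = (|u x| ^ (Q - 1)) ^ 2 := by
    rw [← rpow_natCast, ← rpow_mul h0]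
    congr 1
    rw [hQdef]
    push_cast
    field_simp
    ring
  have h5 : |Q * |u x| ^ (Q - 2) * u x * deriv u x| = Q * |u x| ^ (Q - 1) * |deriv u x| := by
    rw [abs_mul, abs_mul, abs_mul, abs_of_pos (by linarith : 0 < Q),
      abs_of_nonneg (rpow_nonneg h0 _), mul_assoc Q, h3]
  rw [h4, h5, ← sq_abs (deriv u x), ← sq_abs z]
  nth_rewrite 2 [← sq_sqrt hR.le]
  have h6 : 0 ≤ (n - 1) * (|deriv u x| / (n - 2) - √R * |z| * |u x| ^ (Q - 1)) ^ 2 :=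
    mul_nonneg (by linarith) (sq_nonneg _)
  have h7 : (n - 1) / (n - 2) ^ 2 * |deriv u x| ^ 2 +
      (n - 1) * √R ^ 2 * (|z| ^ 2 * (|u x| ^ (Q - 1)) ^ 2) -
      √R * (|z| * (Q * |u x| ^ (Q - 1) * |deriv u x|)) =
      (n - 1) * (|deriv u x| / (n - 2) - √R * |z| * |u x| ^ (Q - 1)) ^ 2 := by
    rw [hQdef]
    field_simp
    ring
  linarith

lemma lintegral_transport_le {n : ℝ} (hn : 2 < n) {u : ℝ → ℝ} (hu : ContDiff ℝ 1 u)
    (hc : HasCompactSupport u) {R : ℝ} (hR : 0 < R) {w Z : ℝ → ℝ}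
    (h : ∀ φ : ℝ → ℝ, ContDiff ℝ 1 φ → HasCompactSupport φ → (∀ x, 0 ≤ φ x) →
      (∀ x, u x = 0 → φ x = 0) →
      ∫⁻ x, ENNReal.ofReal (w x * φ x) ≤ ∫⁻ x, ENNReal.ofReal (|Z x| * |deriv φ x|)) :
    ∫⁻ x, ENNReal.ofReal (√R * w x) * ENNReal.ofReal (|u x| ^ (2 * (n - 1) / (n - 2))) ≤
      ENNReal.ofReal ((n - 1) / (n - 2) ^ 2) * (∫⁻ x, ENNReal.ofReal (deriv u x ^ 2)) +
        ∫⁻ x, ENNReal.ofReal ((n - 1) * R * Z x ^ 2) *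
          ENNReal.ofReal (|u x| ^ (2 * n / (n - 2))) := by
  have h2 : 0 < n - 2 := by linarith
  have h1 : 0 < n - 1 := by linarith
  have hQ : 1 < 2 * (n - 1) / (n - 2) := by
    rw [lt_div_iff₀ h2]; linarith
  have hQ0 : 2 * (n - 1) / (n - 2) ≠ 0 := by linarith
  have hφ := h (fun t => |u t| ^ (2 * (n - 1) / (n - 2)))
    (by simpa only [Real.norm_eq_abs] using hu.norm_rpow hQ)
    (hc.comp_left (g := fun t : ℝ => |t| ^ (2 * (n - 1) / (n - 2))) (by simp [hQ0]))
    (fun x => by positivity) (fun x hx => by simp [hx, hQ0])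
  calc _ = ENNReal.ofReal (√R) * ∫⁻ x, ENNReal.ofReal (w x * |u x| ^ (2 * (n - 1) / (n - 2))) := by
        rw [← lintegral_const_mul' _ _ ENNReal.ofReal_ne_top]
        congr with x
        rw [ENNReal.ofReal_mul (sqrt_nonneg R), mul_assoc,
          ← ENNReal.ofReal_mul' (by positivity)]
    _ ≤ ENNReal.ofReal (√R) * ∫⁻ x, ENNReal.ofReal
          (|Z x| * |deriv (fun t => |u t| ^ (2 * (n - 1) / (n - 2))) x|) := by gcongr
    _ = ∫⁻ x, ENNReal.ofReal
          (√R * (|Z x| * |deriv (fun t => |u t| ^ (2 * (n - 1) / (n - 2))) x|)) := by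
        rw [← lintegral_const_mul' _ _ ENNReal.ofReal_ne_top]
        congr with x
        rw [ENNReal.ofReal_mul (sqrt_nonneg R)]
    _ ≤ ∫⁻ x, (ENNReal.ofReal ((n - 1) / (n - 2) ^ 2) * ENNReal.ofReal (deriv u x ^ 2) +
          ENNReal.ofReal ((n - 1) * R * Z x ^ 2) *
          ENNReal.ofReal (|u x| ^ (2 * n / (n - 2)))) := by
        refine lintegral_mono fun x => ?_
        rw [← ENNReal.ofReal_mul (by positivity), ← ENNReal.ofReal_mul (by positivity),
          ← ENNReal.ofReal_add (by positivity) (by positivity), mul_assoc ((n - 1) * R)]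
        exact ENNReal.ofReal_le_ofReal
          (abs_deriv_abs_rpow_le hn (hu.differentiable (by simp)) hR x (Z x))
    _ = _ := by
        have hm : Measurable (deriv u) := measurable_deriv u
        rw [lintegral_add_left (by fun_prop), lintegral_const_mul _ (by fun_prop)]

lemma DualSobolev.slice {n m k : ℕ} (hn : 3 ≤ n) (hmk : m + (k + 1) = n)
    (h : DualSobolev n m (k + 1)) {u : (Fin m → ℝ) → ℝ} (hu : ContDiff ℝ 1 u)
    (hc : HasCompactSupport u) {R δ d z : ℝ} (hR : 0 < R) (hδ : 0 < δ)
    (hd : 0 ≤ d) {F : ℝ} (hF : F = ∫ x, |u x| ^ (2 * (n : ℝ) / (n - 2)))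
    (hz : δ ^ k * d = studentProd n m * (R * (1 + z ^ 2)) ^ ((n : ℝ) - m / 2) * F) :
    ENNReal.ofReal (((n : ℝ) - 1) * (2 * n - m) / (2 * n - m - 2) * R * (1 + z ^ 2)) *
        ENNReal.ofReal F ≤
      (ENNReal.ofReal (k * δ) + ENNReal.ofReal d) *
          (∫⁻ x, ENNReal.ofReal (|u x| ^ (2 * ((n : ℝ) - 1) / (n - 2)))) +
        ENNReal.ofReal (((n : ℝ) - 1) / (n - 2) ^ 2) *
          ∫⁻ x, ENNReal.ofReal (∑ i, fderiv ℝ u x (Pi.single i 1) ^ 2) := by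
  have hn' : (3 : ℝ) ≤ n := by exact_mod_cast hn
  have h2 : (0 : ℝ) < n - 2 := by linarith
  have hP : 0 < 2 * (n : ℝ) / (n - 2) := by positivity
  have hF0 : 0 ≤ F := hF ▸ integral_nonneg fun x => by positivity
  rcases hF0.eq_or_lt with h0 | h0
  · simp [← h0]
  have hκ := studentProd_pos hn (by omega : m ≤ n)
  have hR' : 0 < R * (1 + z ^ 2) := by positivity
  have hd' : 0 < d := by
    refine hd.lt_of_ne fun h3 => ?_
    rw [← h3, mul_zero] at hz
    have : 0 < studentProd n m * (R * (1 + z ^ 2)) ^ ((n : ℝ) - m / 2) * F := by positivity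
    linarith
  have hint : Integrable fun x => |u x| ^ (2 * (n : ℝ) / (n - 2)) := by
    refine Continuous.integrable_of_hasCompactSupport ?_
      (hc.comp_left (g := fun t : ℝ => |t| ^ (2 * (n : ℝ) / (n - 2))) (by simp [hP.ne']))
    have := hu.continuous
    exact this.abs.rpow_const fun _ => Or.inr hP.le
  have hδ' : ((δ ^ k * d) ^ (1 / ((k : ℝ) + 1))) ^ (k + 1) = δ ^ k * d := by
    rw [← rpow_natCast, ← rpow_mul (by positivity)]
    push_cast
    rw [one_div_mul_cancel (by positivity), rpow_one]
  have key := h u hu hc (R * (1 + z ^ 2)) ((δ ^ k * d) ^ (1 / ((k : ℝ) + 1))) hR' (by positivity)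
    (by rw [hδ', hz, hF])
  rw [← ofReal_integral_eq_lintegral_ofReal hint (ae_of_all _ fun x => by positivity), ← hF,
    ← mul_assoc] at key
  refine key.trans ?_
  gcongr
  rw [← ENNReal.ofReal_add (by positivity) hd]
  exact ENNReal.ofReal_le_ofReal (natCast_succ_mul_rpow_le hδ hd')

theorem DualSobolev.succ {n m k : ℕ} (hn : 3 ≤ n) (hmk : m + (k + 1) = n)
    (h : DualSobolev n m (k + 1)) : DualSobolev n (m + 1) k := by
  intro u hu hc R δ hR hδ hδk
  have hn' : (3 : ℝ) ≤ n := by exact_mod_cast hn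
  have hm : (m : ℝ) + 1 ≤ n := by exact_mod_cast (by omega : m + 1 ≤ n)
  have h2 : (0 : ℝ) < n - 2 := by linarith
  have hP : 0 < 2 * (n : ℝ) / (n - 2) := by positivity
  have hQ : 0 < 2 * ((n : ℝ) - 1) / (n - 2) := div_pos (by linarith) h2
  set P := 2 * (n : ℝ) / (n - 2) with hPdef
  set Q := 2 * ((n : ℝ) - 1) / (n - 2) with hQdef
  set b := ((n : ℝ) - 1) / (n - 2) ^ 2 with hbdef
  set s := (n : ℝ) - m / 2 with hsdef
  have hs : 3 / 2 < s := by rw [hsdef]; linarith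
  have hκ := studentProd_pos hn (by omega : m ≤ n)
  have hσ : 0 < studentMass s := studentMass_pos (by linarith)
  have hκ1 : studentProd n (m + 1) = studentProd n m * (studentMass s)⁻¹ :=
    Finset.prod_range_succ _ _
  have huc := hu.continuous
  have hPc : Continuous fun x => |u x| ^ P := huc.abs.rpow_const fun _ => Or.inr hP.le
  have hPs : HasCompactSupport fun x => |u x| ^ P :=
    hc.comp_left (g := fun t : ℝ => |t| ^ P) (by simp [hP.ne'])
  have hQc : Continuous fun x => |u x| ^ Q := huc.abs.rpow_const fun _ => Or.inr hQ.le
  have hPi : Integrable fun x => |u x| ^ P := hPc.integrable_of_hasCompactSupport hPs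
  set F : ℝ → ℝ := fun x => ∫ y : Fin m → ℝ, |u (Fin.cons x y)| ^ P with hFdef
  have hFc : Continuous F := continuous_integral_finCons hPc hPs
  have hFi : Integrable F := (integrable_comp_finCons hPc hPs).integral_prod_left
  have hF0 : ∀ x, 0 ≤ F x := fun x => integral_nonneg fun y => by positivity
  have hFM : ∫ x, F x = ∫ z, |u z| ^ P := integral_finCons hPc hPs
  set M := ∫ z, |u z| ^ P with hMdef
  have hM : 0 < M := by
    refine (integral_nonneg fun y => by positivity : 0 ≤ M).lt_of_ne fun (h3 : 0 = M) => ?_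
    rw [← h3, mul_zero] at hδk
    exact (pow_pos hδ k).ne' hδk
  have hFl : ∀ x, ENNReal.ofReal (F x) =
      ∫⁻ y : Fin m → ℝ, ENNReal.ofReal (|u (Fin.cons x y)| ^ P) := fun x =>
    ofReal_integral_eq_lintegral_ofReal
      ((hPc.comp (contDiff_finCons_right x).continuous).integrable_of_hasCompactSupport
        (hasCompactSupport_comp_finCons_right hPs x))
      (ae_of_all _ fun y => by positivity)
  obtain ⟨Z, hZ, hZ2, hZφ⟩ := exists_student_transport hs hFc hFi hF0 (hFM ▸ hM)
  rw [hFM] at hZ2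
  simp only [hFM] at hZφ
  set w : ℝ → ℝ := fun x => studentMass s * F x / M * (1 + Z x ^ 2) ^ s with hwdef
  have hw0 : ∀ x, 0 ≤ w x := fun x => by
    have := hF0 x
    positivity
  have hwm : Measurable w := by fun_prop
  have hF_zero : ∀ x, F x = 0 → ∀ y, u (Fin.cons x y) = 0 := by
    intro x hx y
    by_contra hne
    have h3 := Continuous.integral_pos_of_hasCompactSupport_nonneg_nonzero (μ := volume)
      (f := fun y : Fin m → ℝ => |u (Fin.cons x y)| ^ P) (x := y)
      (hPc.comp (contDiff_finCons_right x).continuous)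
      (hasCompactSupport_comp_finCons_right hPs x) (fun y => by positivity)
      (by positivity)
    exact h3.ne' hx
  have hFd : Continuous (fderiv ℝ u) := hu.continuous_fderiv (by simp)
  set D : Fin (m + 1) → (Fin (m + 1) → ℝ) → ENNReal := fun i z =>
    ENNReal.ofReal (fderiv ℝ u z (Pi.single i 1) ^ 2) with hDdef
  have hDm : ∀ i, Measurable (D i) := fun i => by
    have : Continuous fun z => fderiv ℝ u z (Pi.single i 1) := by fun_prop
    fun_prop
  -- the bound on each slice
  have hslice : ∀ x, ENNReal.ofReal (((n : ℝ) - 1) * (2 * n - m) / (2 * n - m - 2) * R *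
      (1 + Z x ^ 2)) * ENNReal.ofReal (F x) ≤
      (ENNReal.ofReal (k * δ) + ENNReal.ofReal (√R * w x)) *
          (∫⁻ y : Fin m → ℝ, ENNReal.ofReal (|u (Fin.cons x y)| ^ Q)) +
        ENNReal.ofReal b * ∫⁻ y : Fin m → ℝ, ∑ i : Fin m, D i.succ (Fin.cons x y) := by
    intro x
    have h3 := h.slice hn hmk (u := fun y => u (Fin.cons x y)) (hu.comp (contDiff_finCons_right x))
      (hasCompactSupport_comp_finCons_right hc x) (R := R) (δ := δ) (d := √R * w x) (z := Z x)
      hR hδ (mul_nonneg (sqrt_nonneg _) (hw0 x)) (F := F x) rfl ?_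
    · refine h3.trans_eq ?_
      congr 3 with y
      rw [ENNReal.ofReal_sum_of_nonneg fun i _ => sq_nonneg _]
      simp only [fderiv_comp_finCons_right hu, hDdef]
    · rw [← hsdef, hδk, hκ1, mul_rpow hR.le (by positivity), hwdef, sqrt_eq_rpow]
      have h4 : R ^ s = R ^ ((n : ℝ) - (m + 1 : ℕ) / 2) * R ^ (1 / 2 : ℝ) := by
        rw [← rpow_add hR]
        congr 1
        rw [hsdef]; push_cast; ring
      rw [h4]
      field_simp
  have hswap : ∀ {g : ℝ → ENNReal} {f : (Fin (m + 1) → ℝ) → ENNReal}, Measurable g →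
      Measurable f → ∫⁻ x, g x * ∫⁻ y : Fin m → ℝ, f (Fin.cons x y) =
        ∫⁻ y : Fin m → ℝ, ∫⁻ x, g x * f (Fin.cons x y) := by
    intro g f hg hf
    have hf' := hf.comp continuous_finCons_prod.measurable
    rw [lintegral_lintegral_swap]
    · congr with x
      rw [lintegral_const_mul]
      exact hf'.comp measurable_prodMk_left
    · exact (((hg.comp measurable_fst).mul hf').comp measurable_swap).aemeasurable
  have hmeas : ∀ {f : (Fin (m + 1) → ℝ) → ENNReal}, Measurable f →
      Measurable fun x : ℝ => ∫⁻ y : Fin m → ℝ, f (Fin.cons x y) := fun hf =>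
    (hf.comp continuous_finCons_prod.measurable).lintegral_prod_right'
  have hmeas' : ∀ {f : (Fin (m + 1) → ℝ) → ENNReal}, Measurable f →
      Measurable fun y : Fin m → ℝ => ∫⁻ x : ℝ, f (Fin.cons x y) := fun hf =>
    (hf.comp continuous_finCons_prod.measurable).lintegral_prod_left'
  have hPm : Measurable fun z => ENNReal.ofReal (|u z| ^ P) := by fun_prop
  have hQm : Measurable fun z => ENNReal.ofReal (|u z| ^ Q) := by fun_prop
  have hZF : ∀ c : ℝ, 0 ≤ c → ∫⁻ x, ENNReal.ofReal (c * Z x ^ 2) * ENNReal.ofReal (F x) =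
      ENNReal.ofReal (c * (M / (2 * s - 3))) := by
    intro c hc0
    rw [ENNReal.ofReal_mul hc0, ← hZ2, ← lintegral_const_mul _ (by fun_prop)]
    congr with x
    rw [← ENNReal.ofReal_mul (by positivity), ← ENNReal.ofReal_mul hc0]
    congr 1
    ring
  -- transport in the first variable
  have htrans : ∫⁻ x, ENNReal.ofReal (√R * w x) *
      (∫⁻ y : Fin m → ℝ, ENNReal.ofReal (|u (Fin.cons x y)| ^ Q)) ≤
      ENNReal.ofReal b * (∫⁻ z, D 0 z) + ENNReal.ofReal ((n - 1) * R * (M / (2 * s - 3))) := by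
    rw [hswap (by fun_prop) hQm]
    calc _ ≤ ∫⁻ y : Fin m → ℝ, (ENNReal.ofReal b * (∫⁻ x, D 0 (Fin.cons x y)) +
          ∫⁻ x, ENNReal.ofReal ((n - 1) * R * Z x ^ 2) *
            ENNReal.ofReal (|u (Fin.cons x y)| ^ P)) := by
          refine lintegral_mono fun y => ?_
          have h3 := lintegral_transport_le (n := n) (by linarith)
            (hu.comp (contDiff_finCons_left y))
            (hasCompactSupport_comp_finCons_left hc y) hR
            (w := w) fun φ hφ1 hφ2 hφ3 hφ4 =>
              hZφ φ hφ1 hφ2 hφ3 fun x hx => hφ4 x (hF_zero x hx y)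
          refine h3.trans_eq ?_
          congr 3 with x
          rw [hDdef]
          congr 2
          have h4 : HasDerivAt (fun x : ℝ => u (Fin.cons x y)) _ x :=
            HasFDerivAt.comp_hasDerivAt x
              ((hu.differentiable (by simp)) (Fin.cons x y)).hasFDerivAt
              (hasDerivAt_finCons_left x y)
          exact h4.deriv
      _ = ENNReal.ofReal b * (∫⁻ z, D 0 z) +
          ∫⁻ x, ENNReal.ofReal ((n - 1) * R * Z x ^ 2) * ENNReal.ofReal (F x) := by
          rw [lintegral_add_left ((hmeas' (hDm 0)).const_mul _),
            lintegral_const_mul _ (hmeas' (hDm 0)), ← hswap (by fun_prop) hPm]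
          simp only [hFl]
          congr 2
          rw [lintegral_finCons (hDm 0), lintegral_lintegral_swap]
          exact (((hDm 0).comp continuous_finCons_prod.measurable).comp
            measurable_swap).aemeasurable
      _ = _ := by rw [hZF _ (mul_nonneg (by linarith) hR.le)]
  have hS : ∫⁻ z, ENNReal.ofReal (∑ i, fderiv ℝ u z (Pi.single i 1) ^ 2) =
      (∫⁻ z, D 0 z) + ∫⁻ x : ℝ, ∫⁻ y : Fin m → ℝ, ∑ i : Fin m, D i.succ (Fin.cons x y) := by
    rw [← lintegral_finCons (f := fun z => ∑ i : Fin m, D i.succ z)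
      (Finset.measurable_fun_sum _ fun i _ => hDm i.succ), ← lintegral_add_left (hDm 0)]
    congr with z
    rw [ENNReal.ofReal_sum_of_nonneg fun i _ => sq_nonneg _, Fin.sum_univ_succ]
  have h2s : 2 * s - 3 = 2 * n - m - 3 := by rw [hsdef]; ring
  have h2s0 : 0 < 2 * s - 3 := by linarith
  have ham : 0 ≤ ((n : ℝ) - 1) * (2 * n - m) / (2 * n - m - 2) * R := by
    refine mul_nonneg (div_nonneg (mul_nonneg ?_ ?_) ?_) hR.le <;> linarith
  have hint := lintegral_mono (μ := volume) hslice
  have hL : ∫⁻ x, ENNReal.ofReal (((n : ℝ) - 1) * (2 * n - m) / (2 * n - m - 2) * R *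
      (1 + Z x ^ 2)) * ENNReal.ofReal (F x) =
      ENNReal.ofReal (((n : ℝ) - 1) * (2 * n - (m + 1 : ℕ)) / (2 * n - (m + 1 : ℕ) - 2) * R * M) +
        ENNReal.ofReal ((n - 1) * R * (M / (2 * s - 3))) := by
    have hc0 : 0 ≤ ((n : ℝ) - 1) * R := mul_nonneg (by linarith) hR.le
    have hMs : 0 ≤ M / (2 * s - 3) := by positivity
    have ham1 : 0 ≤ ((n : ℝ) - 1) * (2 * n - (m + 1 : ℕ)) / (2 * n - (m + 1 : ℕ) - 2) * R := by
      push_cast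
      refine mul_nonneg (div_nonneg (mul_nonneg ?_ ?_) ?_) hR.le <;> linarith
    rw [← ENNReal.ofReal_add (by positivity) (by positivity)]
    calc _ = ∫⁻ x, (ENNReal.ofReal (((n : ℝ) - 1) * (2 * n - m) / (2 * n - m - 2) * R) *
          ENNReal.ofReal (F x) +
          ENNReal.ofReal (((n : ℝ) - 1) * (2 * n - m) / (2 * n - m - 2) * R * Z x ^ 2) *
            ENNReal.ofReal (F x)) := by
          congr with x
          rw [← add_mul, ← ENNReal.ofReal_add ham (by positivity)]
          congr 2
          ring
      _ = ENNReal.ofReal (((n : ℝ) - 1) * (2 * n - m) / (2 * n - m - 2) * R * M +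
            ((n : ℝ) - 1) * (2 * n - m) / (2 * n - m - 2) * R * (M / (2 * s - 3))) := by
          rw [lintegral_add_left (by fun_prop), hZF _ ham, lintegral_const_mul _ (by fun_prop),
            ← ofReal_integral_eq_lintegral_ofReal hFi (ae_of_all _ hF0), hFM,
            ← ENNReal.ofReal_mul ham, ← ENNReal.ofReal_add (by positivity) (by positivity)]
      _ = _ := by
          congr 1
          push_cast
          have h5 : 2 * (n : ℝ) - m = 2 * s - 3 + 3 := by linarith
          have h6 : 2 * (n : ℝ) - (m + 1) = 2 * s - 3 + 2 := by linarith
          rw [h5, h6]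
          generalize 2 * s - 3 = e at h2s0 ⊢
          rw [show e + 3 - 2 = e + 1 by ring, show e + 2 - 2 = e by ring]
          field_simp
          ring
  have hRint : ∫⁻ x, ((ENNReal.ofReal (k * δ) + ENNReal.ofReal (√R * w x)) *
          (∫⁻ y : Fin m → ℝ, ENNReal.ofReal (|u (Fin.cons x y)| ^ Q)) +
        ENNReal.ofReal b * ∫⁻ y : Fin m → ℝ, ∑ i : Fin m, D i.succ (Fin.cons x y)) =
      ENNReal.ofReal (k * δ) * (∫⁻ z, ENNReal.ofReal (|u z| ^ Q)) +
        (∫⁻ x, ENNReal.ofReal (√R * w x) *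
          (∫⁻ y : Fin m → ℝ, ENNReal.ofReal (|u (Fin.cons x y)| ^ Q))) +
        ENNReal.ofReal b * ∫⁻ x : ℝ, ∫⁻ y : Fin m → ℝ, ∑ i : Fin m, D i.succ (Fin.cons x y) := by
    have hGm := hmeas hQm
    have hHm := hmeas (f := fun z => ∑ i : Fin m, D i.succ z)
      (Finset.measurable_fun_sum _ fun i _ => hDm i.succ)
    rw [lintegral_add_right _ (hHm.const_mul _), lintegral_const_mul _ hHm]
    simp only [add_mul]
    rw [lintegral_add_left (hGm.const_mul _), lintegral_const_mul _ hGm, ← lintegral_finCons hQm]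
  rw [hL, hRint] at hint
  rw [← ofReal_integral_eq_lintegral_ofReal hPi (ae_of_all _ fun x => by positivity), ← hMdef,
    ← ENNReal.ofReal_mul' hM.le, hS]
  refine (ENNReal.add_le_add_iff_right (ENNReal.ofReal_ne_top
    (r := (n - 1) * R * (M / (2 * s - 3))))).1 (hint.trans ?_)
  refine (add_le_add_left (add_le_add_right htrans _) _).trans_eq ?_
  ring

theorem dualSobolev {n m k : ℕ} (hn : 3 ≤ n) (hmk : m + k = n) : DualSobolev n m k := by
  induction m generalizing k with
  | zero =>
    obtain rfl : k = n := by omega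
    exact dualSobolev_zero hn
  | succ m ih => exact (ih (by omega)).succ hn (by omega)

lemma studentProd_eq {n m : ℕ} (hn : 3 ≤ n) (hm : m ≤ n) :
    (studentProd n m)⁻¹ = π ^ ((m : ℝ) / 2) * Gamma ((n : ℝ) - m / 2) / Gamma n := by
  have hn' : (3 : ℝ) ≤ n := by exact_mod_cast hn
  have hΓ : ∀ j : ℕ, j ≤ n → Gamma ((n : ℝ) - j / 2) ≠ 0 := fun j hj => by
    have : (j : ℝ) ≤ n := by exact_mod_cast hj
    exact (Gamma_pos_of_pos (by linarith)).ne'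
  induction m with
  | zero =>
    have := hΓ 0 (by omega)
    simp only [CharP.cast_eq_zero, zero_div, sub_zero] at this
    simp [studentProd, this]
  | succ m ih =>
    have h1 := hΓ m (by omega)
    have h2 : studentProd n (m + 1) = studentProd n m * (studentMass ((n : ℝ) - m / 2))⁻¹ :=
      Finset.prod_range_succ _ _
    rw [h2, mul_inv, inv_inv, ih (by omega), studentMass, sqrt_eq_rpow]
    have h3 : (n : ℝ) - m / 2 - 1 / 2 = n - (m + 1 : ℕ) / 2 := by push_cast; ring
    have h4 : π ^ (((m + 1 : ℕ) : ℝ) / 2) = π ^ ((m : ℝ) / 2) * π ^ (1 / 2 : ℝ) := by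
      rw [← rpow_add pi_pos]
      congr 1
      push_cast; ring
    rw [h3, h4]
    generalize Gamma ((n : ℝ) - m / 2) = g at h1
    field_simp

lemma sobolevConst_eq {n : ℕ} (hn : 3 ≤ n) :
    sobolevConst n = n * (n - 2) * studentProd n n ^ (-(2 / (n : ℝ))) := by
  have hn' : (3 : ℝ) ≤ n := by exact_mod_cast hn
  have hκ := studentProd_pos hn le_rfl
  have hΓ := Gamma_pos_of_pos (by linarith : (0 : ℝ) < n)
  have hΓ2 := Gamma_pos_of_pos (by linarith : (0 : ℝ) < (n : ℝ) / 2)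
  rw [rpow_neg hκ.le, ← inv_rpow hκ.le, studentProd_eq hn le_rfl,
    show (n : ℝ) - n / 2 = n / 2 by ring, mul_div_assoc, mul_rpow (by positivity) (by positivity),
    ← rpow_mul pi_pos.le, show (n : ℝ) / 2 * (2 / n) = 1 by field_simp, rpow_one, sobolevConst]
  ring

lemma sobolev_pi {n : ℕ} (hn : 3 ≤ n) {u : (Fin n → ℝ) → ℝ} (hu : ContDiff ℝ 1 u)
    (hc : HasCompactSupport u) :
    ENNReal.ofReal (sobolevConst n *
        (∫ x, |u x| ^ (2 * (n : ℝ) / (n - 2))) ^ (((n : ℝ) - 2) / n)) ≤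
      ∫⁻ x, ENNReal.ofReal (∑ i, fderiv ℝ u x (Pi.single i 1) ^ 2) := by
  have hn' : (3 : ℝ) ≤ n := by exact_mod_cast hn
  have h2 : (0 : ℝ) < n - 2 := by linarith
  have h1 : (0 : ℝ) < n - 1 := by linarith
  have hP : 0 < 2 * (n : ℝ) / (n - 2) := by positivity
  have hκ := studentProd_pos hn le_rfl
  have hint : Integrable fun x => |u x| ^ (2 * (n : ℝ) / (n - 2)) := by
    refine Continuous.integrable_of_hasCompactSupport ?_
      (hc.comp_left (g := fun t : ℝ => |t| ^ (2 * (n : ℝ) / (n - 2))) (by simp [hP.ne']))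
    have := hu.continuous
    exact this.abs.rpow_const fun _ => Or.inr hP.le
  have h := dualSobolev hn (add_zero n) u hu hc
  rw [← ofReal_integral_eq_lintegral_ofReal hint (ae_of_all _ fun x => by positivity)] at h
  set M := ∫ x, |u x| ^ (2 * (n : ℝ) / (n - 2)) with hM
  have hM0 : 0 ≤ M := integral_nonneg fun y => by positivity
  rcases hM0.eq_or_lt with h0 | h0
  · rw [← h0, zero_rpow (by positivity)]
    simp
  set κ := studentProd n n with hκdef
  have h3 := h ((κ * M) ^ (-(2 / (n : ℝ)))) 1 (by positivity) one_pos (by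
    rw [← rpow_mul (by positivity),
      show -(2 / (n : ℝ)) * (n - n / 2) = -1 by field_simp; ring, rpow_neg_one, pow_zero]
    field_simp)
  simp only [CharP.cast_eq_zero, zero_mul, ENNReal.ofReal_zero, zero_add] at h3
  rw [← ENNReal.ofReal_mul' h0.le] at h3
  have hb : 0 < ((n : ℝ) - 1) / (n - 2) ^ 2 := by positivity
  rw [← ENNReal.mul_le_mul_iff_right (ENNReal.ofReal_pos.2 hb).ne' ENNReal.ofReal_ne_top,
    ← ENNReal.ofReal_mul hb.le]
  refine (ENNReal.ofReal_le_ofReal (le_of_eq ?_)).trans h3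
  rw [sobolevConst_eq hn, ← hκdef, mul_rpow hκ.le h0.le]
  have h5 : M ^ (-(2 / (n : ℝ))) * M = M ^ (((n : ℝ) - 2) / n) := by
    nth_rewrite 2 [← rpow_one M]
    rw [← rpow_add h0]
    congr 1
    field_simp
    ring
  rw [← h5, show 2 * (n : ℝ) - n - 2 = n - 2 by ring, show 2 * (n : ℝ) - n = n by ring]
  generalize M ^ (-(2 / (n : ℝ))) = y
  field_simp

lemma sq_norm_gradient {n : ℕ} (w : EuclideanSpace ℝ (Fin n) → ℝ) (x : EuclideanSpace ℝ (Fin n)) :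
    ‖gradient w x‖ ^ 2 = ∑ i, fderiv ℝ w x (EuclideanSpace.single i 1) ^ 2 := by
  rw [EuclideanSpace.norm_sq_eq]
  congr with i
  have h : fderiv ℝ w x (EuclideanSpace.single i 1) =
      inner ℝ (gradient w x) (EuclideanSpace.single i 1) := by
    rw [gradient, InnerProductSpace.toDual_symm_apply]
  rw [h, EuclideanSpace.inner_single_right]
  simp

theorem sobolev {n : ℕ} (hn : 3 ≤ n) {w : EuclideanSpace ℝ (Fin n) → ℝ} (hw : ContDiff ℝ 1 w)
    (hc : HasCompactSupport w) :
    ENNReal.ofReal (sobolevConst n *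
        (∫ x, |w x| ^ (2 * (n : ℝ) / (n - 2))) ^ (((n : ℝ) - 2) / n)) ≤
      ∫⁻ x, ENNReal.ofReal (‖gradient w x‖ ^ 2) := by
  set e := (EuclideanSpace.equiv (Fin n) ℝ).symm with he
  have hmp : MeasurePreserving (MeasurableEquiv.toLp 2 (Fin n → ℝ)) :=
    PiLp.volume_preserving_toLp (Fin n)
  have h := sobolev_pi hn (u := fun y => w (e y)) (hw.comp e.contDiff)
    (hc.comp_homeomorph e.toHomeomorph)
  have h1 : ∫ y, |w (e y)| ^ (2 * (n : ℝ) / (n - 2)) = ∫ x, |w x| ^ (2 * (n : ℝ) / (n - 2)) :=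
    hmp.integral_comp' (fun x => |w x| ^ (2 * (n : ℝ) / (n - 2)))
  have h2 : ∫⁻ y, ENNReal.ofReal (‖gradient w (e y)‖ ^ 2) =
      ∫⁻ x, ENNReal.ofReal (‖gradient w x‖ ^ 2) :=
    hmp.lintegral_comp_emb (MeasurableEquiv.measurableEmbedding _)
      (fun x => ENNReal.ofReal (‖gradient w x‖ ^ 2))
  rw [h1] at h
  rw [← h2]
  refine h.trans_eq ?_
  congr with y
  congr 1
  rw [sq_norm_gradient]
  congr with i
  congr 1
  have h3 : HasFDerivAt (fun y => w (e y)) _ y :=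
    ((hw.differentiable (by simp)) (e y)).hasFDerivAt.comp y e.hasFDerivAt
  rw [h3.fderiv]
  rfl

section FlatStretch

open Filter Topology

/-- The function `q ↦ exp (a - q ^ (-k/2) / k) * q ^ (-α)` on the positive half-line, extended
by zero. -/
noncomputable def flatPow (k a α q : ℝ) : ℝ :=
  if q ≤ 0 then 0 else exp (a - q ^ (-(k / 2)) / k) * q ^ (-α)

lemma flatPow_of_pos {k a α q : ℝ} (hq : 0 < q) :
    flatPow k a α q = exp (a - q ^ (-(k / 2)) / k) * q ^ (-α) := if_neg hq.not_ge

lemma flatPow_of_nonpos {k a α q : ℝ} (hq : q ≤ 0) : flatPow k a α q = 0 := if_pos hq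

lemma continuousAt_flatPow_zero {k : ℝ} (hk : 0 < k) (a α : ℝ) :
    ContinuousAt (flatPow k a α) 0 := by
  rw [ContinuousAt, flatPow_of_nonpos le_rfl]
  suffices h : Tendsto (flatPow k a α) (𝓝[≤] 0 ⊔ 𝓝[>] 0) (𝓝 0) by
    rwa [nhdsLE_sup_nhdsGT] at h
  refine tendsto_sup.2 ⟨?_, ?_⟩
  · refine tendsto_const_nhds.congr' ?_
    filter_upwards [self_mem_nhdsWithin] with q hq
    exact (flatPow_of_nonpos hq).symm
  · have h1 : Tendsto (fun q : ℝ => q ^ (-(k / 2))) (𝓝[>] 0) atTop :=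
      tendsto_rpow_neg_nhdsGT_zero (by linarith)
    have h2 := (tendsto_rpow_mul_exp_neg_mul_atTop_nhds_zero (2 * α / k) (1 / k)
      (by positivity)).comp h1
    have h3 := h2.const_mul (exp a)
    rw [mul_zero] at h3
    refine h3.congr' ?_
    filter_upwards [self_mem_nhdsWithin] with q hq
    have hq : 0 < q := hq
    rw [flatPow_of_pos hq, Function.comp_apply, ← rpow_mul hq.le,
      show -(k / 2) * (2 * α / k) = -α by field_simp, sub_eq_add_neg, exp_add]
    ring_nf

lemma hasDerivAt_flatPow_of_ne {k : ℝ} (hk : 0 < k) (a α : ℝ) {q : ℝ} (hq : q ≠ 0) :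
    HasDerivAt (flatPow k a α)
      (flatPow k a (α + k / 2 + 1) q / 2 - α * flatPow k a (α + 1) q) q := by
  rcases hq.lt_or_gt with hq | hq
  · rw [flatPow_of_nonpos hq.le, flatPow_of_nonpos hq.le]
    simp only [zero_div, mul_zero, sub_zero]
    refine (hasDerivAt_const q (0 : ℝ)).congr_of_eventuallyEq ?_
    filter_upwards [eventually_lt_nhds hq] with y hy using flatPow_of_nonpos hy.le
  · have h1 : HasDerivAt (fun q : ℝ => exp (a - q ^ (-(k / 2)) / k) * q ^ (-α)) _ q :=
      (((hasDerivAt_rpow_const (p := -(k / 2)) (Or.inl hq.ne')).div_const k).const_sub a).exp.mul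
        (hasDerivAt_rpow_const (p := -α) (Or.inl hq.ne'))
    have h2 := h1.congr_of_eventuallyEq (f₁ := flatPow k a α) (by
      filter_upwards [eventually_gt_nhds hq] with y hy using flatPow_of_pos hy)
    refine h2.congr_deriv ?_
    rw [flatPow_of_pos hq, flatPow_of_pos hq,
      show -(α + k / 2 + 1) = (-(k / 2) - 1) + -α by ring, rpow_add hq,
      show -(α + 1) = -α - 1 by ring]
    field_simp
    ring

lemma continuous_flatPow {k : ℝ} (hk : 0 < k) (a α : ℝ) : Continuous (flatPow k a α) := by
  refine continuous_iff_continuousAt.2 fun q => ?_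
  rcases eq_or_ne q 0 with rfl | hq
  · exact continuousAt_flatPow_zero hk a α
  · exact (hasDerivAt_flatPow_of_ne hk a α hq).continuousAt

lemma hasDerivAt_flatPow {k : ℝ} (hk : 0 < k) (a α q : ℝ) :
    HasDerivAt (flatPow k a α)
      (flatPow k a (α + k / 2 + 1) q / 2 - α * flatPow k a (α + 1) q) q := by
  rcases eq_or_ne q 0 with rfl | hq
  · refine hasDerivAt_of_hasDerivAt_of_ne
      (g := fun q => flatPow k a (α + k / 2 + 1) q / 2 - α * flatPow k a (α + 1) q)
      (fun y hy => hasDerivAt_flatPow_of_ne hk a α hy) (continuousAt_flatPow_zero hk a α) ?_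
    exact ((continuousAt_flatPow_zero hk a _).div_const 2).sub
      (continuousAt_const.mul (continuousAt_flatPow_zero hk a _))
  · exact hasDerivAt_flatPow_of_ne hk a α hq

lemma contDiff_flatPow {k : ℝ} (hk : 0 < k) (a α : ℝ) : ContDiff ℝ 1 (flatPow k a α) := by
  rw [contDiff_one_iff_deriv]
  refine ⟨fun q => (hasDerivAt_flatPow hk a α q).differentiableAt, ?_⟩
  rw [funext fun q => (hasDerivAt_flatPow hk a α q).deriv]
  have h1 := continuous_flatPow hk a (α + k / 2 + 1)
  have h2 := continuous_flatPow hk a (α + 1)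
  fun_prop

/-- The radius `exp (a - ρ ^ (-k) / k)` to which the sphere of radius `ρ` is moved. -/
noncomputable def radialStretch (k a ρ : ℝ) : ℝ := exp (a - ρ ^ (-k) / k)

lemma radialStretch_pos (k a ρ : ℝ) : 0 < radialStretch k a ρ := exp_pos _

lemma hasDerivAt_radialStretch {k : ℝ} (hk : 0 < k) (a : ℝ) {ρ : ℝ} (hρ : 0 < ρ) :
    HasDerivAt (radialStretch k a) (radialStretch k a ρ * ρ ^ (-(k + 1))) ρ := by
  have h1 : HasDerivAt (fun q : ℝ => exp (a - q ^ (-k) / k)) _ ρ :=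
    (((hasDerivAt_rpow_const (p := -k) (Or.inl hρ.ne')).div_const k).const_sub a).exp
  refine h1.congr_deriv ?_
  rw [show -(k + 1) = -k - 1 by ring, radialStretch]
  field_simp

lemma flatPow_sq {k a α ρ : ℝ} (hρ : 0 < ρ) :
    flatPow k a α (ρ ^ 2) = radialStretch k a ρ * ρ ^ (-(2 * α)) := by
  rw [flatPow_of_pos (by positivity), radialStretch, ← rpow_natCast, ← rpow_mul hρ.le,
    ← rpow_mul hρ.le]
  congr <;> push_cast <;> ring

lemma strictMonoOn_radialStretch {k : ℝ} (hk : 0 < k) (a : ℝ) :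
    StrictMonoOn (radialStretch k a) (Set.Ioi 0) := by
  intro x hx y hy hxy
  have := rpow_lt_rpow_of_neg hx hxy (neg_neg_of_pos hk)
  unfold radialStretch
  gcongr

lemma lt_one_of_radialStretch_lt_one {k a ρ : ℝ} (hk : 0 < k) (ha : 1 / k ≤ a)
    (h : radialStretch k a ρ < 1) : ρ < 1 := by
  by_contra! h1
  have h2 : ρ ^ (-k) ≤ 1 := rpow_le_one_of_one_le_of_nonpos h1 (by linarith)
  have h3 : ρ ^ (-k) / k ≤ a := le_trans (by gcongr) ha
  refine h.not_ge ?_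
  exact one_le_exp (by linarith)

lemma image_radialStretch {k a : ℝ} (hk : 0 < k) (ha : 0 < a) :
    radialStretch k a '' {ρ | 0 < ρ ∧ radialStretch k a ρ < 1} = Set.Ioo 0 1 := by
  ext s
  constructor
  · rintro ⟨ρ, hρ, rfl⟩
    exact ⟨radialStretch_pos _ _ _, (show _ ∧ _ from hρ).2⟩
  · rintro ⟨h0, h1⟩
    have hl : 0 < k * (a - log s) := mul_pos hk (by linarith [log_neg h0 h1])
    have h2 : radialStretch k a ((k * (a - log s)) ^ (-(1 / k))) = s := by
      rw [radialStretch, ← rpow_mul hl.le, show -(1 / k) * -k = 1 by field_simp, rpow_one,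
        mul_div_cancel_left₀ _ hk.ne', sub_sub_cancel, exp_log h0]
    exact ⟨_, ⟨by positivity, by rwa [h2]⟩, h2⟩

lemma lintegral_Ioo_eq_radialStretch {k a : ℝ} (hk : 0 < k) (ha : 0 < a) (g : ℝ → ENNReal) :
    ∫⁻ s in Set.Ioo (0 : ℝ) 1, g s =
      ∫⁻ ρ in {ρ | 0 < ρ ∧ radialStretch k a ρ < 1},
        ENNReal.ofReal (radialStretch k a ρ * ρ ^ (-(k + 1))) * g (radialStretch k a ρ) := by
  have hm : Measurable (radialStretch k a) := by unfold radialStretch; fun_prop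
  have hs : MeasurableSet {ρ | 0 < ρ ∧ radialStretch k a ρ < 1} :=
    measurableSet_Ioi.inter (hm measurableSet_Iio)
  rw [← image_radialStretch hk ha, lintegral_image_eq_lintegral_abs_deriv_mul hs
    (fun ρ hρ => (hasDerivAt_radialStretch hk a (show _ ∧ _ from hρ).1).hasDerivWithinAt)
    ((strictMonoOn_radialStretch hk a).injOn.mono fun ρ hρ => (show _ ∧ _ from hρ).1)]
  refine setLIntegral_congr_fun hs fun ρ hρ => ?_
  have hρ0 : 0 < ρ := (show _ ∧ _ from hρ).1
  have := radialStretch_pos k a ρ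
  rw [abs_of_nonneg (by positivity)]

lemma X1_radialStretch {k a ρ : ℝ} (hρ : 0 < ρ) :
    X1 a (radialStretch k a ρ) = k * ρ ^ k := by
  rw [X1, radialStretch, log_exp, sub_sub_cancel, inv_div, rpow_neg hρ.le, div_inv_eq_mul]

end FlatStretch

lemma lintegral_eq_lintegral_sphere {E : Type*} [NormedAddCommGroup E] [NormedSpace ℝ E]
    [Nontrivial E] [FiniteDimensional ℝ E] [MeasurableSpace E] [BorelSpace E]
    (μ : Measure E) [μ.IsAddHaarMeasure] {f : E → ENNReal} (hf : Measurable f) :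
    ∫⁻ x, f x ∂μ = ∫⁻ θ : Metric.sphere (0 : E) 1, (∫⁻ r in Set.Ioi (0 : ℝ),
      ENNReal.ofReal (r ^ (Module.finrank ℝ E - 1)) * f (r • (θ : E))) ∂μ.toSphere := by
  have hmp := μ.measurePreserving_homeomorphUnitSphereProd
  have hs : Measurable fun p : Metric.sphere (0 : E) 1 × Set.Ioi (0 : ℝ) =>
      f ((p.2 : ℝ) • (p.1 : E)) := by fun_prop
  calc ∫⁻ x, f x ∂μ = ∫⁻ x in {0}ᶜ, f x ∂μ := by
        have h0 : ∀ᵐ x ∂μ, x ∈ ({0}ᶜ : Set E) := compl_mem_ae_iff.2 (measure_singleton 0)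
        rw [Measure.restrict_eq_self_of_ae_mem h0]
    _ = ∫⁻ x : ({0}ᶜ : Set E), f x ∂(μ.comap (↑)) :=
        (lintegral_subtype_comap (measurableSet_singleton _).compl f).symm
    _ = ∫⁻ x : ({0}ᶜ : Set E), f (((homeomorphUnitSphereProd E x).2 : ℝ) •
          ((homeomorphUnitSphereProd E x).1 : E)) ∂(μ.comap (↑)) := by
        congr with x
        congr 1
        exact congrArg Subtype.val ((homeomorphUnitSphereProd E).symm_apply_apply x).symm
    _ = ∫⁻ p, f ((p.2 : ℝ) • (p.1 : E)) ∂(μ.toSphere.prod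
          (Measure.volumeIoiPow (Module.finrank ℝ E - 1))) := hmp.lintegral_comp hs
    _ = _ := by
        rw [lintegral_prod _ hs.aemeasurable]
        congr with θ
        rw [Measure.volumeIoiPow, lintegral_withDensity_eq_lintegral_mul _ (by fun_prop)
          (by fun_prop)]
        exact lintegral_subtype_comap measurableSet_Ioi
          fun r => ENNReal.ofReal (r ^ (Module.finrank ℝ E - 1)) * f (r • (θ : E))

/-- The radial map `z ↦ (r (‖z‖) / ‖z‖) • z` with `r = radialStretch k a`. -/
noncomputable def radialMap {E : Type*} [NormedAddCommGroup E] [InnerProductSpace ℝ E]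
    (k a : ℝ) (z : E) : E := flatPow k a (1 / 2) (‖z‖ ^ 2) • z

section RadialMap

variable {E : Type*} [NormedAddCommGroup E] [InnerProductSpace ℝ E]

lemma contDiff_radialMap {k : ℝ} (hk : 0 < k) (a : ℝ) :
    ContDiff ℝ 1 (radialMap k a : E → E) :=
  ((contDiff_flatPow hk a _).comp (contDiff_norm_sq ℝ)).smul contDiff_fun_id

lemma radialMap_smul {k a ρ : ℝ} (hρ : 0 < ρ) {θ : E} (hθ : ‖θ‖ = 1) :
    radialMap k a (ρ • θ) = radialStretch k a ρ • θ := by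
  rw [radialMap, norm_smul, hθ, mul_one, norm_of_nonneg hρ.le, flatPow_sq hρ, smul_smul,
    mul_assoc, show -(2 * (1 / 2 : ℝ)) = -1 by ring, rpow_neg_one, inv_mul_cancel₀ hρ.ne', mul_one]

lemma norm_radialMap {k a : ℝ} {z : E} (hz : z ≠ 0) :
    ‖radialMap k a z‖ = radialStretch k a ‖z‖ := by
  have hz' : 0 < ‖z‖ := norm_pos_iff.2 hz
  have h := radialMap_smul (k := k) (a := a) hz' (θ := ‖z‖⁻¹ • z)
    (by rw [norm_smul, norm_inv, norm_norm, inv_mul_cancel₀ hz'.ne'])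
  rw [smul_smul, mul_inv_cancel₀ hz'.ne', one_smul] at h
  rw [h, norm_smul, norm_smul, norm_inv, norm_norm, inv_mul_cancel₀ hz'.ne', mul_one,
    norm_of_nonneg (radialStretch_pos _ _ _).le]

lemma norm_fderiv_radialMap_le {k : ℝ} (hk : 0 < k) (a : ℝ) {z : E} (hz : z ≠ 0)
    (hz1 : ‖z‖ ≤ 1) :
    ‖fderiv ℝ (radialMap k a) z‖ ≤ radialStretch k a ‖z‖ * ‖z‖ ^ (-(k + 1)) := by
  have hρ : 0 < ‖z‖ := norm_pos_iff.2 hz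
  set ρ := ‖z‖ with hρdef
  have hr := radialStretch_pos k a ρ
  have h1 := (hasDerivAt_flatPow hk a (1 / 2) (‖z‖ ^ 2)).comp_hasFDerivAt z
    (f := fun z : E => ‖z‖ ^ 2) (hasStrictFDerivAt_norm_sq z).hasFDerivAt
  have h2 : HasFDerivAt (radialMap k a) _ z := h1.smul (hasFDerivAt_id z)
  rw [h2.fderiv]
  have h3 : ρ ^ (-1 : ℝ) ≤ ρ ^ (-(k + 1)) :=
    rpow_le_rpow_of_exponent_ge hρ hz1 (by linarith)
  refine ContinuousLinearMap.opNorm_le_bound _ (by positivity) fun y => ?_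
  simp only [Function.comp_apply, ← hρdef]
  rw [flatPow_sq hρ, flatPow_sq hρ, flatPow_sq hρ]
  have e1 : ρ ^ (-(2 * (1 / 2 + k / 2 + 1))) = ρ ^ (-(k + 1)) * ρ ^ (-2 : ℝ) := by
    rw [← rpow_add hρ]; ring_nf
  have e2 : ρ ^ (-(2 * (1 / 2 + 1 : ℝ))) = ρ ^ (-1 : ℝ) * ρ ^ (-2 : ℝ) := by
    rw [← rpow_add hρ]; ring_nf
  have e3 : ρ ^ (-(2 * (1 / 2) : ℝ)) = ρ ^ (-1 : ℝ) := by ring_nf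
  have e4 : ρ ^ (-2 : ℝ) * ρ ^ 2 = 1 := by
    rw [← rpow_natCast, ← rpow_add hρ]; norm_num
  rw [e1, e2, e3]
  set A := ρ ^ (-(k + 1))
  set B := ρ ^ (-1 : ℝ)
  set C := ρ ^ (-2 : ℝ) with hC
  have hC0 : 0 < C := by positivity
  set r := radialStretch k a ρ
  have h5 : |inner ℝ z y| ≤ ρ * ‖y‖ := abs_real_inner_le_norm z y
  have h6 : 0 ≤ r * (A - B) * C :=
    mul_nonneg (mul_nonneg hr.le (sub_nonneg.2 h3)) hC0.le
  calc _ = ‖(r * B) • y + (r * (A - B) * C * inner ℝ z y) • z‖ := by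
        congr 1
        simp only [add_apply, smul_apply,
          ContinuousLinearMap.smulRight_apply, innerSL_apply_apply, smul_eq_mul,
          nsmul_eq_mul, ContinuousLinearMap.id_apply]
        congr 2
        push_cast
        ring
    _ ≤ r * B * ‖y‖ + r * (A - B) * C * (ρ * ‖y‖) * ρ := by
        refine (norm_add_le _ _).trans ?_
        rw [norm_smul, norm_smul, norm_of_nonneg (by positivity : 0 ≤ r * B), norm_mul,
          norm_of_nonneg h6]
        gcongr
        exact h5
    _ = r * A * ‖y‖ := by linear_combination r * (A - B) * ‖y‖ * e4

end RadialMap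

lemma measurableSet_radialStretch_norm_lt_one {E : Type*} [NormedAddCommGroup E]
    [MeasurableSpace E] [BorelSpace E] (k a : ℝ) :
    MeasurableSet {z : E | z ≠ 0 ∧ radialStretch k a ‖z‖ < 1} := by
  have hm : Measurable (radialStretch k a) := by unfold radialStretch; fun_prop
  exact (measurableSet_singleton 0).compl.inter ((hm.comp measurable_norm) measurableSet_Iio)

lemma lintegral_ball_eq_lintegral_radialMap {E : Type*} [NormedAddCommGroup E]
    [InnerProductSpace ℝ E] [Nontrivial E] [FiniteDimensional ℝ E] [MeasurableSpace E]
    [BorelSpace E] (μ : Measure E) [μ.IsAddHaarMeasure] {k a : ℝ} (hk : 0 < k) (ha : 0 < a)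
    {f : E → ENNReal} (hf : Measurable f) :
    ∫⁻ x in Metric.ball 0 1, f x ∂μ = ∫⁻ z in {z | z ≠ 0 ∧ radialStretch k a ‖z‖ < 1},
      ENNReal.ofReal (radialStretch k a ‖z‖ ^ Module.finrank ℝ E *
        ‖z‖ ^ (-(k + Module.finrank ℝ E))) * f (radialMap k a z) ∂μ := by
  have hm : Measurable (radialStretch k a) := by unfold radialStretch; fun_prop
  have hU := measurableSet_radialStretch_norm_lt_one (E := E) k a
  have hs : MeasurableSet {ρ | 0 < ρ ∧ radialStretch k a ρ < 1} :=
    measurableSet_Ioi.inter (hm measurableSet_Iio)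
  have hs0 : {ρ | 0 < ρ ∧ radialStretch k a ρ < 1} ⊆ Set.Ioi 0 :=
    fun ρ hρ => (show _ ∧ _ from hρ).1
  have hd : 1 ≤ Module.finrank ℝ E := Module.finrank_pos
  set d := Module.finrank ℝ E
  have hR : Measurable (radialMap k a : E → E) := (contDiff_radialMap hk a).continuous.measurable
  rw [← lintegral_indicator Metric.isOpen_ball.measurableSet, ← lintegral_indicator hU,
    lintegral_eq_lintegral_sphere μ (hf.indicator Metric.isOpen_ball.measurableSet),
    lintegral_eq_lintegral_sphere μ (Measurable.indicator (by fun_prop) hU)]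
  congr with θ
  have hθ : ‖(θ : E)‖ = 1 := norm_eq_of_mem_sphere θ
  calc _ = ∫⁻ r in Set.Ioi (0 : ℝ), (Set.Ioo 0 1).indicator
          (fun r => ENNReal.ofReal (r ^ (d - 1)) * f (r • (θ : E))) r := by
        refine setLIntegral_congr_fun measurableSet_Ioi fun r hr => ?_
        have hr : 0 < r := hr
        have h1 : r • (θ : E) ∈ Metric.ball (0 : E) 1 ↔ r ∈ Set.Ioo (0 : ℝ) 1 := by
          rw [mem_ball_zero_iff, norm_smul, hθ, mul_one, norm_of_nonneg hr.le]
          exact (and_iff_right hr).symm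
        by_cases h : r ∈ Set.Ioo (0 : ℝ) 1
        · rw [Set.indicator_of_mem (h1.2 h), Set.indicator_of_mem h]
        · rw [Set.indicator_of_notMem (mt h1.1 h), Set.indicator_of_notMem h, mul_zero]
    _ = ∫⁻ r in Set.Ioo (0 : ℝ) 1, ENNReal.ofReal (r ^ (d - 1)) * f (r • (θ : E)) := by
        rw [setLIntegral_indicator measurableSet_Ioo,
          Set.inter_eq_left.2 Set.Ioo_subset_Ioi_self]
    _ = ∫⁻ ρ in Set.Ioi (0 : ℝ), {ρ | 0 < ρ ∧ radialStretch k a ρ < 1}.indicator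
          (fun ρ => ENNReal.ofReal (radialStretch k a ρ * ρ ^ (-(k + 1))) *
            (ENNReal.ofReal (radialStretch k a ρ ^ (d - 1)) *
              f (radialStretch k a ρ • (θ : E)))) ρ := by
        rw [lintegral_Ioo_eq_radialStretch hk ha, setLIntegral_indicator hs,
          Set.inter_eq_left.2 hs0]
    _ = _ := by
        refine setLIntegral_congr_fun measurableSet_Ioi fun ρ hρ => ?_
        have hρ : 0 < ρ := hρ
        have hn : ‖ρ • (θ : E)‖ = ρ := by rw [norm_smul, hθ, mul_one, norm_of_nonneg hρ.le]
        have h1 : ρ • (θ : E) ∈ {z : E | z ≠ 0 ∧ radialStretch k a ‖z‖ < 1} ↔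
            ρ ∈ {ρ | 0 < ρ ∧ radialStretch k a ρ < 1} := by
          rw [Set.mem_ofPred_eq, Set.mem_ofPred_eq, ← norm_pos_iff, hn]
        have hr := radialStretch_pos k a ρ
        by_cases h : ρ ∈ {ρ | 0 < ρ ∧ radialStretch k a ρ < 1}
        · rw [Set.indicator_of_mem h, Set.indicator_of_mem (h1.2 h), hn, radialMap_smul hρ hθ,
            ← mul_assoc, ← mul_assoc, ← ENNReal.ofReal_mul (by positivity),
            ← ENNReal.ofReal_mul (by positivity)]
          congr 2
          have e1 : ρ ^ (-(k + 1)) = ρ ^ (d - 1) * ρ ^ (-(k + d)) := by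
            rw [← rpow_natCast, ← rpow_add hρ]
            push_cast [hd]
            ring_nf
          have e2 : radialStretch k a ρ ^ d =
              radialStretch k a ρ * radialStretch k a ρ ^ (d - 1) := by
            rw [← pow_succ', Nat.sub_add_cancel hd]
          rw [e1, e2]
          ring
        · rw [Set.indicator_of_notMem h, Set.indicator_of_notMem (mt h1.1 h), mul_zero]

lemma continuous_gradient {E : Type*} [NormedAddCommGroup E] [InnerProductSpace ℝ E]
    [CompleteSpace E] {v : E → ℝ} (hv : ContDiff ℝ 1 v) : Continuous (gradient v) :=
  (InnerProductSpace.toDual ℝ E).symm.continuous.comp (hv.continuous_fderiv one_ne_zero)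

lemma gradient_comp_radialMap_sq_le {E : Type*} [NormedAddCommGroup E] [InnerProductSpace ℝ E]
    [CompleteSpace E] {k : ℝ} (hk : 0 < k) (a : ℝ) {v : E → ℝ} (hv : Differentiable ℝ v) {z : E}
    (hz : z ≠ 0) (hz1 : ‖z‖ ≤ 1) :
    ‖gradient (v ∘ radialMap k a) z‖ ^ 2 ≤
      (radialStretch k a ‖z‖ * ‖z‖ ^ (-(k + 1)) * ‖gradient v (radialMap k a z)‖) ^ 2 := by
  have hR : DifferentiableAt ℝ (radialMap k a) z :=
    (contDiff_radialMap hk a).differentiable one_ne_zero z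
  have h := norm_fderiv_radialMap_le hk a hz hz1
  gcongr
  rw [gradient, gradient, LinearIsometryEquiv.norm_map, LinearIsometryEquiv.norm_map,
    fderiv_comp _ (hv _) hR, mul_comm]
  exact (ContinuousLinearMap.opNorm_comp_le _ _).trans (by gcongr)

section BallToSpace

variable {n : ℕ} {k a : ℝ} {v : EuclideanSpace ℝ (Fin n) → ℝ}

lemma comp_radialMap_eventually_zero (hk : 0 < k)
    (hsupp : tsupport v ⊆ Metric.ball (0 : EuclideanSpace ℝ (Fin n)) 1)
    {z : EuclideanSpace ℝ (Fin n)} (hz : z ≠ 0) (h : ¬ radialStretch k a ‖z‖ < 1) :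
    v ∘ radialMap k a =ᶠ[nhds z] 0 := by
  have h1 : radialMap k a z ∉ tsupport v := fun h' => by
    have := hsupp h'
    rw [mem_ball_zero_iff, norm_radialMap hz] at this
    exact h this
  exact (contDiff_radialMap hk a).continuous.continuousAt.eventually
    (notMem_tsupport_iff_eventuallyEq.1 h1)

lemma hasCompactSupport_comp_radialMap (hk : 0 < k) (ha : 1 / k ≤ a)
    (hsupp : tsupport v ⊆ Metric.ball (0 : EuclideanSpace ℝ (Fin n)) 1) :
    HasCompactSupport (v ∘ radialMap k a) := by
  refine HasCompactSupport.intro (isCompact_closedBall 0 1) fun z hz => ?_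
  rw [mem_closedBall_zero_iff, not_le] at hz
  have hz0 : z ≠ 0 := norm_pos_iff.1 (by linarith)
  exact (comp_radialMap_eventually_zero hk hsupp hz0
    fun h => (lt_one_of_radialStretch_lt_one hk ha h).not_gt hz).eq_of_nhds

lemma lintegral_ball_weight_gradient (hn : 3 ≤ n) (hk : k = n - 2) (ha : 0 < a)
    (hv : ContDiff ℝ 1 v) :
    ∫⁻ x in Metric.ball (0 : EuclideanSpace ℝ (Fin n)) 1,
        ENNReal.ofReal (‖x‖ ^ (-k) * ‖gradient v x‖ ^ 2) =
      ∫⁻ z in {z | z ≠ 0 ∧ radialStretch k a ‖z‖ < 1}, ENNReal.ofReal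
        ((radialStretch k a ‖z‖ * ‖z‖ ^ (-(k + 1)) * ‖gradient v (radialMap k a z)‖) ^ 2) := by
  have hn' : (3 : ℝ) ≤ n := by exact_mod_cast hn
  have hk0 : 0 < k := by linarith
  have : NeZero n := ⟨by omega⟩
  have hg := continuous_gradient hv
  rw [lintegral_ball_eq_lintegral_radialMap volume hk0 ha (by fun_prop)]
  refine setLIntegral_congr_fun (measurableSet_radialStretch_norm_lt_one k a) fun z hz => ?_
  have hz0 : z ≠ 0 := (show _ ∧ _ from hz).1
  have hρ : 0 < ‖z‖ := norm_pos_iff.2 hz0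
  have hr := radialStretch_pos k a ‖z‖
  rw [norm_radialMap hz0, finrank_euclideanSpace_fin, ← ENNReal.ofReal_mul (by positivity)]
  congr 1
  have e1 : radialStretch k a ‖z‖ ^ n * radialStretch k a ‖z‖ ^ (-k) =
      radialStretch k a ‖z‖ ^ 2 := by
    rw [← rpow_natCast, ← rpow_natCast, ← rpow_add hr, hk]
    push_cast
    ring_nf
  have e2 : ‖z‖ ^ (-(k + n)) = (‖z‖ ^ (-(k + 1))) ^ 2 := by
    rw [← rpow_natCast, ← rpow_mul hρ.le, hk]
    push_cast
    ring_nf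
  rw [e2, mul_pow, mul_pow, ← e1]
  ring

lemma lintegral_gradient_comp_radialMap_le (hn : 3 ≤ n) (hk : k = n - 2) (ha : 1 / k ≤ a)
    (hv : ContDiff ℝ 1 v)
    (hsupp : tsupport v ⊆ Metric.ball (0 : EuclideanSpace ℝ (Fin n)) 1) :
    ∫⁻ z, ENNReal.ofReal (‖gradient (v ∘ radialMap k a) z‖ ^ 2) ≤
      ∫⁻ x in Metric.ball (0 : EuclideanSpace ℝ (Fin n)) 1,
        ENNReal.ofReal (‖x‖ ^ (-k) * ‖gradient v x‖ ^ 2) := by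
  have hn' : (3 : ℝ) ≤ n := by exact_mod_cast hn
  have hk0 : 0 < k := by linarith
  have : NeZero n := ⟨by omega⟩
  rw [lintegral_ball_weight_gradient hn hk (lt_of_lt_of_le (by positivity) ha) hv,
    ← lintegral_indicator (measurableSet_radialStretch_norm_lt_one k a)]
  have h0 : ∀ᵐ z : EuclideanSpace ℝ (Fin n), z ∈ ({0}ᶜ : Set _) :=
    compl_mem_ae_iff.2 (measure_singleton 0)
  refine lintegral_mono_ae ?_
  filter_upwards [h0] with z hz
  have hz : z ≠ 0 := hz
  by_cases h : radialStretch k a ‖z‖ < 1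
  · rw [Set.indicator_of_mem (by exact And.intro hz h)]
    exact ENNReal.ofReal_le_ofReal (gradient_comp_radialMap_sq_le hk0 a
      (hv.differentiable one_ne_zero) hz (lt_one_of_radialStretch_lt_one hk0 ha h).le)
  · have h1 : gradient (v ∘ radialMap k a) z = 0 := by
      rw [gradient, (comp_radialMap_eventually_zero hk0 hsupp hz h).fderiv_eq]
      simp
    simp [h1]

lemma lintegral_ball_weight_gradient_lt_top (hn : 3 ≤ n) (hk : k = n - 2) (ha : 1 / k ≤ a)
    (hv : ContDiff ℝ 1 v) :
    ∫⁻ x in Metric.ball (0 : EuclideanSpace ℝ (Fin n)) 1,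
        ENNReal.ofReal (‖x‖ ^ (-k) * ‖gradient v x‖ ^ 2) < ⊤ := by
  have hn' : (3 : ℝ) ≤ n := by exact_mod_cast hn
  have hk0 : 0 < k := by linarith
  rw [lintegral_ball_weight_gradient hn hk (lt_of_lt_of_le (by positivity) ha) hv]
  have hc : Continuous fun z : EuclideanSpace ℝ (Fin n) =>
      (flatPow k a ((k + 1) / 2) (‖z‖ ^ 2) * ‖gradient v (radialMap k a z)‖) ^ 2 := by
    have h1 := continuous_flatPow hk0 a ((k + 1) / 2)
    have h2 := continuous_gradient hv
    have h3 := (contDiff_radialMap (E := EuclideanSpace ℝ (Fin n)) hk0 a).continuous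
    fun_prop
  have hU : {z : EuclideanSpace ℝ (Fin n) | z ≠ 0 ∧ radialStretch k a ‖z‖ < 1} ⊆
      Metric.closedBall 0 1 := fun z hz => by
    rw [mem_closedBall_zero_iff]
    exact (lt_one_of_radialStretch_lt_one hk0 ha (show _ ∧ _ from hz).2).le
  rw [setLIntegral_congr_fun (measurableSet_radialStretch_norm_lt_one k a)
    (g := fun z => ENNReal.ofReal
      ((flatPow k a ((k + 1) / 2) (‖z‖ ^ 2) * ‖gradient v (radialMap k a z)‖) ^ 2))]
  · exact ((hc.continuousOn.integrableOn_compact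
      (isCompact_closedBall 0 1)).mono_set hU).lintegral_lt_top
  · intro z hz
    simp only
    rw [flatPow_sq (norm_pos_iff.2 (show _ ∧ _ from hz).1), mul_div_cancel₀ _ two_ne_zero]

lemma integral_ball_weight_eq (hn : 3 ≤ n) (hk : k = n - 2) (ha : 0 < a) (hv : ContDiff ℝ 1 v)
    (hsupp : tsupport v ⊆ Metric.ball (0 : EuclideanSpace ℝ (Fin n)) 1) {p : ℝ} (hp : 0 < p) :
    ∫ x in Metric.ball (0 : EuclideanSpace ℝ (Fin n)) 1,
        ‖x‖ ^ (-(n : ℝ)) * X1 a ‖x‖ ^ (2 * ((n : ℝ) - 1) / k) * |v x| ^ p =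
      k ^ (2 * ((n : ℝ) - 1) / k) * ∫ z, |(v ∘ radialMap k a) z| ^ p := by
  have hn' : (3 : ℝ) ≤ n := by exact_mod_cast hn
  have hk0 : 0 < k := by linarith
  have : NeZero n := ⟨by omega⟩
  have hX : ∀ x ∈ Metric.ball (0 : EuclideanSpace ℝ (Fin n)) 1, 0 ≤ X1 a ‖x‖ := fun x hx => by
    have := log_nonpos (norm_nonneg x) (mem_ball_zero_iff.1 hx).le
    exact inv_nonneg.2 (by linarith)
  have hXm : Measurable (X1 a) := by unfold X1; fun_prop
  have hvm := hv.continuous.measurable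
  have hRm := (contDiff_radialMap (E := EuclideanSpace ℝ (Fin n)) hk0 a).continuous.measurable
  rw [← integral_const_mul, integral_eq_lintegral_of_nonneg_ae, integral_eq_lintegral_of_nonneg_ae]
  rotate_left
  · exact Filter.Eventually.of_forall fun z => by positivity
  · exact Measurable.aestronglyMeasurable (by fun_prop)
  · filter_upwards [ae_restrict_mem Metric.isOpen_ball.measurableSet] with x hx
    have := hX x hx
    positivity
  · exact Measurable.aestronglyMeasurable (by fun_prop)
  congr 1
  rw [lintegral_ball_eq_lintegral_radialMap volume hk0 ha (by fun_prop),
    ← lintegral_indicator (measurableSet_radialStretch_norm_lt_one k a)]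
  have h0 : ∀ᵐ z : EuclideanSpace ℝ (Fin n), z ∈ ({0}ᶜ : Set _) :=
    compl_mem_ae_iff.2 (measure_singleton 0)
  refine lintegral_congr_ae ?_
  filter_upwards [h0] with z hz
  have hz : z ≠ 0 := hz
  have hρ : 0 < ‖z‖ := norm_pos_iff.2 hz
  have hr := radialStretch_pos k a ‖z‖
  by_cases h : radialStretch k a ‖z‖ < 1
  · rw [Set.indicator_of_mem (by exact And.intro hz h), norm_radialMap hz,
      finrank_euclideanSpace_fin, X1_radialStretch hρ,
      ← ENNReal.ofReal_mul (by positivity), mul_rpow hk0.le (by positivity), ← rpow_mul hρ.le,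
      mul_div_cancel₀ _ hk0.ne']
    congr 1
    have e1 : radialStretch k a ‖z‖ ^ n * radialStretch k a ‖z‖ ^ (-(n : ℝ)) = 1 := by
      rw [← rpow_natCast, ← rpow_add hr, add_neg_cancel, rpow_zero]
    have e2 : ‖z‖ ^ (-(k + n)) * ‖z‖ ^ (2 * ((n : ℝ) - 1)) = 1 := by
      rw [← rpow_add hρ, hk]
      ring_nf
      exact rpow_zero _
    rw [Function.comp_apply]
    linear_combination k ^ (2 * ((n : ℝ) - 1) / k) * |v (radialMap k a z)| ^ p * (e1 *
      ‖z‖ ^ (-(k + n)) * ‖z‖ ^ (2 * ((n : ℝ) - 1)) + e2)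
  · have h1 : (v ∘ radialMap k a) z = 0 :=
      (comp_radialMap_eventually_zero hk0 hsupp hz h).eq_of_nhds
    rw [Set.indicator_of_notMem (by exact fun h' => h (And.right h')), h1, abs_zero,
      zero_rpow hp.ne', mul_zero, ENNReal.ofReal_zero]

end BallToSpace

theorem stmt7 (n : ℕ) (hn : 3 ≤ n) (a : ℝ) (ha : 1 / ((n : ℝ) - 2) ≤ a)
    (v : EuclideanSpace ℝ (Fin n) → ℝ) (hu : ContDiff ℝ (⊤ : ℕ∞) v)
    (hcs : HasCompactSupport v)
    (hsupp : tsupport v ⊆ Metric.ball (0 : EuclideanSpace ℝ (Fin n)) 1) :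
    (∫ x in Metric.ball (0 : EuclideanSpace ℝ (Fin n)) 1, ‖x‖ ^ (-((n : ℝ) - 2)) * ‖gradient v x‖ ^ 2)
      ≥ ((n : ℝ) - 2) ^ (-(2 * ((n : ℝ) - 1)) / (n : ℝ)) * sobolevConst n *
          (∫ x in Metric.ball (0 : EuclideanSpace ℝ (Fin n)) 1,
              ‖x‖ ^ (-(n : ℝ)) * (X1 a ‖x‖) ^ (2 * ((n : ℝ) - 1) / ((n : ℝ) - 2)) *
                |v x| ^ (2 * (n : ℝ) / ((n : ℝ) - 2)))
            ^ (((n : ℝ) - 2) / (n : ℝ)) := by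
  have hn' : (3 : ℝ) ≤ n := by exact_mod_cast hn
  have hk : 0 < (n : ℝ) - 2 := by linarith
  have ha0 : 0 < a := lt_of_lt_of_le (by positivity) ha
  have hv : ContDiff ℝ 1 v := hu.of_le (by exact_mod_cast le_top)
  have hg := continuous_gradient hv
  have h := (sobolev hn (hv.comp (contDiff_radialMap hk a))
    (hasCompactSupport_comp_radialMap hk ha hsupp)).trans
    (lintegral_gradient_comp_radialMap_le hn rfl ha hv hsupp)
  rw [ENNReal.ofReal_le_iff_le_toReal (lintegral_ball_weight_gradient_lt_top hn rfl ha hv).ne,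
    ← integral_eq_lintegral_of_nonneg_ae (Filter.Eventually.of_forall fun x => by positivity)
      (Measurable.aestronglyMeasurable (by fun_prop))] at h
  rw [integral_ball_weight_eq hn rfl ha0 hv hsupp (by positivity),
    mul_rpow (by positivity) (integral_nonneg fun z => by positivity), ← rpow_mul hk.le]
  refine le_trans (le_of_eq ?_) h
  have e : ((n : ℝ) - 2) ^ (-(2 * ((n : ℝ) - 1)) / n) *
      ((n : ℝ) - 2) ^ (2 * ((n : ℝ) - 1) / (n - 2) * ((n - 2) / n)) = 1 := by
    rw [← rpow_add hk, show -(2 * ((n : ℝ) - 1)) / n + 2 * ((n : ℝ) - 1) / (n - 2) * ((n - 2) / n)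
      = 0 by field_simp; ring, rpow_zero]
  linear_combination sobolevConst n * (∫ z, |(v ∘ radialMap (n - 2) a) z| ^
    (2 * (n : ℝ) / (n - 2))) ^ (((n : ℝ) - 2) / n) * e
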